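/- arXiv:2507.13592 — 3 statements merged into one kernel-verified Lean document; each statement's English description precedes it below -/
import Mathlib

section
/- Let m ≥ 11, let G = J(m,2) be the Johnson graph with vertex set V of size n = m(m−1)/2, and let U = U_i be a Delsarte clique. Let D' = A' + 2Ā' be the dissimilarity matrix with distances a = 1, b = 2 of the graph obtained from G by Seidel switching with respect to U. Then for every ℓ ∈ ℝ^V with ℓᵀ j = 1, the signature of F_{D'}(ℓ) is (m − 2, 1). -/
open Matrix

/-- The all-ones matrix. -/
noncomputable def Jmat (V : Type*) : Matrix V V ℝ := Matrix.of fun _ _ => 1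

/-- `F_M(ℓ) = −(I − j ℓᵀ) M (I − ℓ jᵀ)`, where `j` is the all-ones vector. -/
noncomputable def FMat {n : Type*} [Fintype n] [DecidableEq n]
    (M : Matrix n n ℝ) (ℓ : n → ℝ) : Matrix n n ℝ :=
  -((1 - Matrix.vecMulVec (fun _ => 1) ℓ) * M * (1 - Matrix.vecMulVec ℓ (fun _ => 1)))

/-- The switching matrix `I_U`: diagonal with entry `−1` on `U` and `+1` off `U`. -/
noncomputable def switchMat {V : Type*} [Fintype V] [DecidableEq V]
    (U : Finset V) : Matrix V V ℝ :=
  Matrix.diagonal (fun v => if v ∈ U then -1 else 1)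

/-- Number of positive eigenvalues (with multiplicity) of a real symmetric matrix. -/
noncomputable def sigP {V : Type*} [Fintype V] [DecidableEq V] (M : Matrix V V ℝ) : ℕ :=
  if h : M.IsHermitian then Nat.card {i // 0 < h.eigenvalues i} else 0

/-- Number of negative eigenvalues (with multiplicity) of a real symmetric matrix. -/
noncomputable def sigN {V : Type*} [Fintype V] [DecidableEq V] (M : Matrix V V ℝ) : ℕ :=
  if h : M.IsHermitian then Nat.card {i // h.eigenvalues i < 0} else 0

/-- The signature `(p, q)` of a real symmetric matrix: the numbers of positive and
negative eigenvalues counted with multiplicity. -/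
noncomputable def signature {V : Type*} [Fintype V] [DecidableEq V]
    (M : Matrix V V ℝ) : ℕ × ℕ := (sigP M, sigN M)

/-- The adjacency matrix of the Johnson graph `J(m,2)`: vertices are the 2-element
subsets of `{1,…,m}`, two vertices adjacent iff they meet in exactly one point. -/
noncomputable def johnsonA (m : ℕ) :
    Matrix {S : Finset (Fin m) // S.card = 2} {S : Finset (Fin m) // S.card = 2} ℝ :=
  Matrix.of fun S T => if (S.1 ∩ T.1).card = 1 then 1 else 0

section Inertia

variable {V κ : Type*} [Fintype V] [DecidableEq V] [Fintype κ]

/-- A quadratic form in eigenvector coordinates is a weighted sum of squares. -/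
lemma quadratic_eq_sum_eigenvalues {M : Matrix V V ℝ} (hM : M.IsHermitian) (x : V → ℝ) :
    x ⬝ᵥ M *ᵥ x = ∑ i, hM.eigenvalues i *
      (((hM.eigenvectorUnitary : Matrix V V ℝ)ᵀ *ᵥ x) i) ^ 2 := by
  have h := hM.spectral_theorem
  rw [Unitary.conjStarAlgAut_apply] at h
  have h2 : M = (hM.eigenvectorUnitary : Matrix V V ℝ) * diagonal hM.eigenvalues *
      (hM.eigenvectorUnitary : Matrix V V ℝ)ᵀ := by
    conv_lhs => rw [h]
    rfl
  conv_lhs => rw [h2]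
  rw [← mulVec_mulVec, ← mulVec_mulVec, dotProduct_mulVec, ← mulVec_transpose]
  simp only [dotProduct, mulVec_diagonal]
  exact Finset.sum_congr rfl fun i _ => by ring

lemma transpose_eigenvectorUnitary_mul {M : Matrix V V ℝ} (hM : M.IsHermitian) :
    (hM.eigenvectorUnitary : Matrix V V ℝ)ᵀ * (hM.eigenvectorUnitary : Matrix V V ℝ) = 1 :=
  Unitary.coe_star_mul_self hM.eigenvectorUnitary

/-- If the form `ε M` is nonpositive on the kernel of a linear map to `κ → ℝ`, then at most
`card κ` eigenvalues of `ε M` are positive. -/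
lemma card_eigenvalues_le {M : Matrix V V ℝ} (hM : M.IsHermitian) (ε : ℝ)
    (L : (V → ℝ) →ₗ[ℝ] (κ → ℝ)) (hL : ∀ x, L x = 0 → ε * (x ⬝ᵥ M *ᵥ x) ≤ 0) :
    Nat.card {i // 0 < ε * hM.eigenvalues i} ≤ Fintype.card κ := by
  classical
  set W : Matrix V V ℝ := (hM.eigenvectorUnitary : Matrix V V ℝ) with hW
  let B : Matrix V {i // 0 < ε * hM.eigenvalues i} ℝ := W.submatrix id Subtype.val
  have hB : ∀ c i, (Wᵀ *ᵥ (B *ᵥ c)) i.1 = c i := by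
    intro c i
    have h1 : (Wᵀ * B) = (1 : Matrix V V ℝ).submatrix id Subtype.val := by
      rw [← transpose_eigenvectorUnitary_mul hM]
      rfl
    rw [mulVec_mulVec, h1]
    simp [mulVec, dotProduct, Matrix.one_apply, Subtype.val_inj]
  have hB0 : ∀ c i, ¬ 0 < ε * hM.eigenvalues i → (Wᵀ *ᵥ (B *ᵥ c)) i = 0 := by
    intro c i hi
    have h1 : (Wᵀ * B) = (1 : Matrix V V ℝ).submatrix id Subtype.val := by
      rw [← transpose_eigenvectorUnitary_mul hM]
      rfl
    rw [mulVec_mulVec, h1]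
    refine Finset.sum_eq_zero fun j _ => ?_
    have : i ≠ j.1 := fun h => hi (h ▸ j.2)
    simp [this]
  have hinj : Function.Injective (L ∘ₗ B.mulVecLin) := by
    rw [← LinearMap.ker_eq_bot, LinearMap.ker_eq_bot']
    intro c hc
    have h := hL (B *ᵥ c) hc
    rw [quadratic_eq_sum_eigenvalues hM, Finset.mul_sum] at h
    have hnn : ∀ i ∈ Finset.univ, 0 ≤ ε * (hM.eigenvalues i * ((Wᵀ *ᵥ (B *ᵥ c)) i) ^ 2) := by
      intro i _
      by_cases hi : 0 < ε * hM.eigenvalues i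
      · rw [← mul_assoc]; positivity
      · rw [hB0 c i hi]; simp
    have h0 := (Finset.sum_eq_zero_iff_of_nonneg hnn).1 (le_antisymm h (Finset.sum_nonneg hnn))
    funext i
    have := h0 i.1 (Finset.mem_univ _)
    rw [hB, ← mul_assoc] at this
    simpa [i.2.ne'] using this
  have := LinearMap.finrank_le_finrank_of_injective hinj
  simpa using this

/-- If the form `ε M` is positive on the nonzero vectors of `κ → ℝ`, transported along a linear
map, then at least `card κ` eigenvalues of `ε M` are positive. -/
lemma le_card_eigenvalues {M : Matrix V V ℝ} (hM : M.IsHermitian) (ε : ℝ)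
    (L : (κ → ℝ) →ₗ[ℝ] (V → ℝ)) (hL : ∀ c, c ≠ 0 → 0 < ε * (L c ⬝ᵥ M *ᵥ L c)) :
    Fintype.card κ ≤ Nat.card {i // 0 < ε * hM.eigenvalues i} := by
  classical
  set W : Matrix V V ℝ := (hM.eigenvectorUnitary : Matrix V V ℝ) with hW
  let B : Matrix {i // 0 < ε * hM.eigenvalues i} V ℝ := Wᵀ.submatrix Subtype.val id
  have hinj : Function.Injective (B.mulVecLin ∘ₗ L) := by
    rw [← LinearMap.ker_eq_bot, LinearMap.ker_eq_bot']
    intro c hc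
    by_contra hne
    refine absurd (hL c hne) (not_lt.2 ?_)
    rw [quadratic_eq_sum_eigenvalues hM, Finset.mul_sum]
    refine Finset.sum_nonpos fun i _ => ?_
    rw [← mul_assoc]
    by_cases hi : 0 < ε * hM.eigenvalues i
    · have : (Wᵀ *ᵥ L c) i = 0 := congrFun hc ⟨i, hi⟩
      rw [this]; simp
    · exact mul_nonpos_of_nonpos_of_nonneg (not_lt.1 hi) (sq_nonneg _)
  have := LinearMap.finrank_le_finrank_of_injective hinj
  simpa using this

end Inertia

/-- The quadratic form of `FMat M ℓ` is minus the form of `M` on the projection along `ℓ`. -/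
lemma quadratic_FMat {V : Type*} [Fintype V] [DecidableEq V] (M : Matrix V V ℝ) (ℓ x : V → ℝ) :
    x ⬝ᵥ FMat M ℓ *ᵥ x =
      -((x - (∑ S, x S) • ℓ) ⬝ᵥ M *ᵥ (x - (∑ S, x S) • ℓ)) := by
  have h1 : ((1 : Matrix V V ℝ) - vecMulVec ℓ (fun _ => (1 : ℝ))) *ᵥ x = x - (∑ S, x S) • ℓ := by
    rw [sub_mulVec, one_mulVec, vecMulVec_mulVec]
    ext S
    simp [dotProduct, mul_comm]
  have h2 : (1 : Matrix V V ℝ) - vecMulVec (fun _ => (1 : ℝ)) ℓ =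
      ((1 : Matrix V V ℝ) - vecMulVec ℓ (fun _ => (1 : ℝ)))ᵀ := by
    rw [transpose_sub, transpose_one, transpose_vecMulVec]
  rw [FMat, neg_mulVec, dotProduct_neg, ← mulVec_mulVec, ← mulVec_mulVec, h1, h2,
    dotProduct_mulVec, vecMul_transpose, h1]

lemma isHermitian_FMat {V : Type*} [Fintype V] [DecidableEq V] {M : Matrix V V ℝ}
    (hM : M.IsSymm) (ℓ : V → ℝ) : (FMat M ℓ).IsHermitian := by
  rw [Matrix.IsHermitian, conjTranspose_eq_transpose_of_trivial, FMat, transpose_neg,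
    transpose_mul, transpose_mul, transpose_sub, transpose_sub, transpose_one,
    transpose_vecMulVec, transpose_vecMulVec, hM.eq, Matrix.mul_assoc]

section Johnson

/-- The vertex set of the Johnson graph `J(m,2)`. -/
abbrev Pairs (m : ℕ) : Type := {S : Finset (Fin m) // S.card = 2}

/-- Incidence of points and pairs. -/
noncomputable def inc {m : ℕ} (k : Fin m) (S : Pairs m) : ℝ := if k ∈ S.1 then 1 else 0

lemma sum_inc_mul_inc {m : ℕ} (S T : Pairs m) :
    ∑ k, inc k S * inc k T = ((S.1 ∩ T.1).card : ℝ) := by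
  simp [inc, ← ite_and, ← Finset.mem_inter, Finset.inter_comm]

lemma sum_inc {m : ℕ} (S : Pairs m) : ∑ k, inc k S = 2 := by
  simp [inc, S.2]

lemma sum_pairs_inc_of_ne {m : ℕ} {k l : Fin m} (h : k ≠ l) : ∑ S, inc k S * inc l S = 1 := by
  rw [Finset.sum_eq_single (⟨{k, l}, Finset.card_pair h⟩ : Pairs m)]
  · simp [inc]
  · intro S _ hS
    by_contra hne
    have hk : k ∈ S.1 := by by_contra hk; simp [inc, hk] at hne
    have hl : l ∈ S.1 := by by_contra hl; simp [inc, hl] at hne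
    refine hS (Subtype.ext (Finset.eq_of_subset_of_card_le ?_ ?_).symm)
    · intro a ha
      rcases Finset.mem_insert.1 ha with rfl | ha
      · exact hk
      · rwa [Finset.mem_singleton.1 ha]
    · simp [S.2, Finset.card_pair h]
  · simp

lemma sum_pairs_inc {m : ℕ} (k : Fin m) : ∑ S, inc k S = (m : ℝ) - 1 := by
  have h1 : ∑ l, ∑ S, inc k S * inc l S = 2 * ∑ S, inc k S := by
    rw [Finset.sum_comm, Finset.mul_sum]
    exact Finset.sum_congr rfl fun S _ => by rw [← Finset.mul_sum, sum_inc, mul_comm]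
  have h2 : ∑ S, inc k S * inc k S = ∑ S, inc k S :=
    Finset.sum_congr rfl fun S _ => by simp [inc]
  have h3 : ∑ l ∈ Finset.univ.erase k, ∑ S, inc k S * inc l S = (m : ℝ) - 1 := by
    rw [Finset.sum_congr rfl fun l hl => sum_pairs_inc_of_ne (Finset.ne_of_mem_erase hl).symm]
    have hm : 1 ≤ m := k.pos
    simp [Finset.card_erase_of_mem, hm]
  rw [← Finset.add_sum_erase _ _ (Finset.mem_univ k), h2, h3] at h1
  linarith

/-- A linear right inverse of the incidence map. -/
noncomputable def incSection (m : ℕ) : (Fin m → ℝ) →ₗ[ℝ] (Pairs m → ℝ) where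
  toFun z S := (∑ k, inc k S * z k - (∑ k, z k) / ((m : ℝ) - 1)) / ((m : ℝ) - 2)
  map_add' z w := by
    funext S
    simp only [Pi.add_apply, mul_add, Finset.sum_add_distrib]
    ring
  map_smul' c z := by
    funext S
    simp only [Pi.smul_apply, smul_eq_mul, mul_left_comm _ c, ← Finset.mul_sum, RingHom.id_apply]
    ring

lemma sum_inc_incSection {m : ℕ} (hm : 3 ≤ m) (z : Fin m → ℝ) (k : Fin m) :
    ∑ S, inc k S * incSection m z S = z k := by
  have hm' : (3 : ℝ) ≤ m := by exact_mod_cast hm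
  have h1 : ∑ S, inc k S * ∑ l, inc l S * z l = ((m : ℝ) - 2) * z k + ∑ l, z l := by
    simp only [Finset.mul_sum]
    rw [Finset.sum_comm]
    simp only [← mul_assoc, ← Finset.sum_mul]
    have h4 : ∀ l ∈ Finset.univ.erase k, (∑ S, inc k S * inc l S) * z l = z l := fun l hl => by
      rw [sum_pairs_inc_of_ne (Finset.ne_of_mem_erase hl).symm, one_mul]
    rw [← Finset.add_sum_erase _ _ (Finset.mem_univ k),
      ← Finset.add_sum_erase _ z (Finset.mem_univ k), Finset.sum_congr rfl h4]
    have h2 : ∑ S, inc k S * inc k S = (m : ℝ) - 1 := by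
      rw [← sum_pairs_inc k]
      exact Finset.sum_congr rfl fun S _ => by simp [inc]
    rw [h2]
    ring
  have h3 : ∑ S, inc k S * incSection m z S =
      (∑ S, inc k S * ∑ l, inc l S * z l
        - (∑ S, inc k S) * ((∑ l, z l) / ((m : ℝ) - 1))) / ((m : ℝ) - 2) := by
    rw [Finset.sum_mul, ← Finset.sum_sub_distrib, Finset.sum_div]
    refine Finset.sum_congr rfl fun S _ => ?_
    simp only [incSection, LinearMap.coe_mk, AddHom.coe_mk]
    ring
  rw [h3, h1, sum_pairs_inc]
  have ha : (m : ℝ) - 1 ≠ 0 := by linarith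
  have hb : (m : ℝ) - 2 ≠ 0 := by linarith
  field_simp
  ring

lemma sum_sum_inc_mul {m : ℕ} (y : Pairs m → ℝ) :
    ∑ k, ∑ S, inc k S * y S = 2 * ∑ S, y S := by
  rw [Finset.sum_comm, Finset.mul_sum]
  exact Finset.sum_congr rfl fun S _ => by rw [← Finset.sum_mul, sum_inc]

/-- The switching sign of a pair with respect to the Delsarte clique at `i`. -/
noncomputable def sgn {m : ℕ} (i : Fin m) (S : Pairs m) : ℝ := 1 - 2 * inc i S

lemma sgn_mul_sgn {m : ℕ} (i : Fin m) (S : Pairs m) : sgn i S * sgn i S = 1 := by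
  unfold sgn inc
  split_ifs <;> norm_num

lemma sgn_mul_inc {m : ℕ} (i : Fin m) (S : Pairs m) : inc i S * sgn i S = -inc i S := by
  unfold sgn inc
  split_ifs <;> norm_num

/-- The dissimilarity matrix of the switched Johnson graph through the incidence matrix. -/
lemma switched_dissimilarity_apply {m : ℕ} (i : Fin m) (U : Finset (Pairs m))
    (hU : ∀ S, S ∈ U ↔ i ∈ S.1) {A' : Matrix (Pairs m) (Pairs m) ℝ}
    (hA' : A' - (Jmat _ - 1 - A') =
      switchMat U * (johnsonA m - (Jmat _ - 1 - johnsonA m)) * switchMat U) (S T : Pairs m) :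
    (A' + (2 : ℝ) • (Jmat (Pairs m) - 1 - A')) S T =
      3 / 2 - sgn i S * sgn i T * (∑ k, inc k S * inc k T - 1 / 2) := by
  have h := congrFun (congrFun hA' S) T
  have hs : ∀ S : Pairs m, (if S ∈ U then (-1 : ℝ) else 1) = sgn i S := by
    intro S
    simp only [sgn, inc, hU]
    split_ifs <;> norm_num
  simp only [switchMat, mul_diagonal, diagonal_mul, hs, Matrix.sub_apply, Jmat, of_apply,
    johnsonA] at h
  simp only [Matrix.add_apply, Matrix.smul_apply, Matrix.sub_apply, Jmat, of_apply, smul_eq_mul,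
    sum_inc_mul_inc]
  by_cases hST : S = T
  · subst hST
    rw [Finset.inter_self, S.2, one_apply_eq] at *
    have := sgn_mul_sgn i S
    norm_num at h ⊢
    linear_combination -h + 3 / 2 * this
  · rw [one_apply_ne hST] at *
    have hle : (S.1 ∩ T.1).card < 2 := by
      by_contra hge
      have h1 : S.1 ∩ T.1 = S.1 :=
        Finset.eq_of_subset_of_card_le Finset.inter_subset_left (by rw [S.2]; omega)
      have h2 : S.1 ∩ T.1 = T.1 :=
        Finset.eq_of_subset_of_card_le Finset.inter_subset_right (by rw [T.2]; omega)
      exact hST (Subtype.ext (h1.symm.trans h2))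
    interval_cases (S.1 ∩ T.1).card
    · norm_num at h ⊢
      linear_combination -h / 2
    · norm_num at h ⊢
      linear_combination -h / 2

/-- The signed incidence sums of a vector on pairs. -/
noncomputable def signedSum {m : ℕ} (i : Fin m) : (Pairs m → ℝ) →ₗ[ℝ] (Fin m → ℝ) :=
  (Matrix.of fun k S => inc k S * sgn i S).mulVecLin

lemma signedSum_apply {m : ℕ} (i : Fin m) (u : Pairs m → ℝ) (k : Fin m) :
    signedSum i u k = ∑ S, inc k S * (sgn i S * u S) := by
  simp [signedSum, mulVec, dotProduct, mul_assoc]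

lemma sum_sgn_mul {m : ℕ} (i : Fin m) {u : Pairs m → ℝ} (hu : ∑ S, u S = 0) :
    ∑ S, sgn i S * u S = 2 * signedSum i u i := by
  have h : ∀ S, sgn i S * u S = u S + 2 * (inc i S * (sgn i S * u S)) := by
    intro S
    have := sgn_mul_inc i S
    rw [← mul_assoc (inc i S), this, sgn]
    ring
  rw [signedSum_apply, Finset.mul_sum, Finset.sum_congr rfl fun S _ => h S,
    Finset.sum_add_distrib, hu, zero_add]

lemma sum_signedSum {m : ℕ} (i : Fin m) {u : Pairs m → ℝ} (hu : ∑ S, u S = 0) :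
    ∑ k, signedSum i u k = 4 * signedSum i u i := by
  have h := sum_sum_inc_mul fun S => sgn i S * u S
  simp only [← signedSum_apply] at h
  rw [h, sum_sgn_mul i hu]
  ring

lemma quadratic_switched {m : ℕ} (i : Fin m) {D : Matrix (Pairs m) (Pairs m) ℝ}
    (hD : ∀ S T, D S T = 3 / 2 - sgn i S * sgn i T * (∑ k, inc k S * inc k T - 1 / 2))
    {u : Pairs m → ℝ} (hu : ∑ S, u S = 0) :
    -(u ⬝ᵥ D *ᵥ u) = ∑ k, signedSum i u k ^ 2 - 2 * signedSum i u i ^ 2 := by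
  have h1 : -(u ⬝ᵥ D *ᵥ u) = -3 / 2 * ((∑ S, u S) * ∑ T, u T)
      + ∑ k, signedSum i u k * signedSum i u k
      - 1 / 2 * ((∑ S, sgn i S * u S) * ∑ T, sgn i T * u T) := by
    have h2 : ∑ k, signedSum i u k * signedSum i u k =
        ∑ S, ∑ T, (sgn i S * u S) * (sgn i T * u T) * ∑ k, inc k S * inc k T := by
      simp only [signedSum_apply, Finset.sum_mul_sum]
      rw [Finset.sum_comm]
      refine Finset.sum_congr rfl fun S _ => ?_
      rw [Finset.sum_comm]
      refine Finset.sum_congr rfl fun T _ => ?_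
      rw [Finset.mul_sum]
      exact Finset.sum_congr rfl fun k _ => by ring
    rw [h2, Finset.sum_mul_sum, Finset.sum_mul_sum]
    simp only [dotProduct, mulVec, hD]
    rw [Finset.mul_sum, Finset.mul_sum, ← Finset.sum_neg_distrib, ← Finset.sum_add_distrib,
      ← Finset.sum_sub_distrib]
    refine Finset.sum_congr rfl fun S _ => ?_
    rw [Finset.mul_sum, Finset.mul_sum, Finset.mul_sum, ← Finset.sum_neg_distrib,
      ← Finset.sum_add_distrib, ← Finset.sum_sub_distrib]
    exact Finset.sum_congr rfl fun T _ => by ring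
  rw [h1, hu, sum_sgn_mul i hu]
  simp only [sq]
  ring

/-- A linear section of the signed incidence sums. -/
noncomputable def signedSection {m : ℕ} (i : Fin m) : (Fin m → ℝ) →ₗ[ℝ] (Pairs m → ℝ) :=
  (Matrix.diagonal (sgn i)).mulVecLin ∘ₗ incSection m

lemma signedSection_apply {m : ℕ} (i : Fin m) (z : Fin m → ℝ) (S : Pairs m) :
    signedSection i z S = sgn i S * incSection m z S := by
  simp [signedSection, mulVec_diagonal]

lemma signedSum_signedSection {m : ℕ} (hm : 3 ≤ m) (i : Fin m) (z : Fin m → ℝ) :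
    signedSum i (signedSection i z) = z := by
  funext k
  rw [signedSum_apply, ← sum_inc_incSection hm z k]
  refine Finset.sum_congr rfl fun S _ => ?_
  rw [signedSection_apply, ← mul_assoc (sgn i S), sgn_mul_sgn, one_mul]

lemma sum_signedSection {m : ℕ} (hm : 3 ≤ m) (i : Fin m) {z : Fin m → ℝ}
    (hz : ∑ k, z k = 4 * z i) : ∑ S, signedSection i z S = 0 := by
  have h1 := sum_sum_inc_mul (incSection m z)
  simp only [sum_inc_incSection hm] at h1
  have h2 : ∑ S, signedSection i z S =
      ∑ S, incSection m z S - 2 * ∑ S, inc i S * incSection m z S := by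
    rw [Finset.mul_sum, ← Finset.sum_sub_distrib]
    exact Finset.sum_congr rfl fun S _ => by rw [signedSection_apply, sgn]; ring
  rw [h2, sum_inc_incSection hm]
  linarith

end Johnson

section Signature

variable {m : ℕ} {i : Fin m} {D : Matrix (Pairs m) (Pairs m) ℝ}

/-- Points other than `i` and `k₀`. -/
abbrev Others (i k₀ : Fin m) : Type := {k : Fin m // k ≠ i ∧ k ≠ k₀}

lemma card_others {k₀ : Fin m} (h : k₀ ≠ i) : Fintype.card (Others i k₀) = m - 2 := by
  rw [Fintype.card_subtype]
  have : (Finset.univ.filter fun k : Fin m => k ≠ i ∧ k ≠ k₀) = (Finset.univ.erase i).erase k₀ := by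
    ext k; simp [and_comm]
  rw [this, Finset.card_erase_of_mem (by simp [h]), Finset.card_erase_of_mem (by simp)]
  simp
  omega

/-- On vectors coming from the point side, the form of `FMat D ℓ` is explicit. -/
lemma quadratic_FMat_signedSection (hm : 3 ≤ m)
    (hD : ∀ S T, D S T = 3 / 2 - sgn i S * sgn i T * (∑ k, inc k S * inc k T - 1 / 2))
    (ℓ : Pairs m → ℝ) {z : Fin m → ℝ} (hz : ∑ k, z k = 4 * z i) :
    signedSection i z ⬝ᵥ FMat D ℓ *ᵥ signedSection i z = ∑ k, z k ^ 2 - 2 * z i ^ 2 := by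
  have h := sum_signedSection hm i hz
  rw [quadratic_FMat, h, zero_smul, sub_zero, quadratic_switched i hD h,
    signedSum_signedSection hm]

/-- The signed incidence sums of the projection of a vector along `ℓ`. -/
noncomputable def projectedSum (i : Fin m) (ℓ : Pairs m → ℝ) :
    (Pairs m → ℝ) →ₗ[ℝ] (Fin m → ℝ) :=
  signedSum i ∘ₗ (LinearMap.id -
    (∑ S, LinearMap.proj (R := ℝ) (φ := fun _ : Pairs m => ℝ) S).smulRight ℓ)

lemma projectedSum_apply (ℓ x : Pairs m → ℝ) :
    projectedSum i ℓ x = signedSum i (x - (∑ S, x S) • ℓ) := by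
  simp [projectedSum]

lemma sum_sub_smul {ℓ : Pairs m → ℝ} (hℓ : ∑ S, ℓ S = 1) (x : Pairs m → ℝ) :
    ∑ S, (x - (∑ S, x S) • ℓ) S = 0 := by
  simp [← Finset.mul_sum, hℓ]

lemma quadratic_FMat_eq
    (hD : ∀ S T, D S T = 3 / 2 - sgn i S * sgn i T * (∑ k, inc k S * inc k T - 1 / 2))
    {ℓ : Pairs m → ℝ} (hℓ : ∑ S, ℓ S = 1) (x : Pairs m → ℝ) :
    x ⬝ᵥ FMat D ℓ *ᵥ x = ∑ k, projectedSum i ℓ x k ^ 2 - 2 * projectedSum i ℓ x i ^ 2 := by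
  rw [quadratic_FMat, quadratic_switched i hD (sum_sub_smul hℓ x), projectedSum_apply]

lemma sum_projectedSum {ℓ : Pairs m → ℝ} (hℓ : ∑ S, ℓ S = 1) (x : Pairs m → ℝ) :
    ∑ k, projectedSum i ℓ x k = 4 * projectedSum i ℓ x i := by
  rw [projectedSum_apply, sum_signedSum i (sum_sub_smul hℓ x)]

lemma card_pos_le (hm : 11 ≤ m)
    (hD : ∀ S T, D S T = 3 / 2 - sgn i S * sgn i T * (∑ k, inc k S * inc k T - 1 / 2))
    {ℓ : Pairs m → ℝ} (hℓ : ∑ S, ℓ S = 1) (hF : (FMat D ℓ).IsHermitian)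
    {k₀ : Fin m} (hk₀ : k₀ ≠ i) :
    Nat.card {S // 0 < 1 * hF.eigenvalues S} ≤ m - 2 := by
  rw [← card_others hk₀]
  let p : Fin m → (Fin m → ℝ) →ₗ[ℝ] ℝ := LinearMap.proj
  refine card_eigenvalues_le hF 1
    ((LinearMap.pi fun k : Others i k₀ => p k.1 - p k₀) ∘ₗ projectedSum i ℓ) fun x hx => ?_
  have hm' : (11 : ℝ) ≤ m := by exact_mod_cast hm
  have hs := sum_projectedSum (i := i) hℓ x
  rw [quadratic_FMat_eq hD hℓ]
  set z := projectedSum i ℓ x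
  have hc : ∀ k ∈ Finset.univ.erase i, z k = z k₀ := by
    intro k hk
    by_cases h : k = k₀
    · rw [h]
    · have := congrFun hx ⟨k, Finset.ne_of_mem_erase hk, h⟩
      exact sub_eq_zero.1 this
  have hcard : ((Finset.univ.erase i).card : ℝ) = m - 1 := by
    rw [Finset.card_erase_of_mem (Finset.mem_univ _), Finset.card_fin, Nat.cast_sub (by omega)]
    simp
  rw [← Finset.add_sum_erase _ _ (Finset.mem_univ i), Finset.sum_congr rfl hc,
    Finset.sum_const, nsmul_eq_mul, hcard] at hs
  rw [← Finset.add_sum_erase _ _ (Finset.mem_univ i),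
    Finset.sum_congr rfl fun k hk => by rw [hc k hk],
    Finset.sum_const, nsmul_eq_mul, hcard]
  have hi : z i = (m - 1) * z k₀ / 3 := by linarith
  rw [hi]
  have : 0 ≤ ((m : ℝ) - 1) * (m - 10) * z k₀ ^ 2 :=
    mul_nonneg (mul_nonneg (by linarith) (by linarith)) (sq_nonneg _)
  nlinarith

/-- Extension by `0` at `i` and by minus the sum at `k₀`. -/
noncomputable def balancedExtension (i k₀ : Fin m) : (Others i k₀ → ℝ) →ₗ[ℝ] (Fin m → ℝ) :=
  LinearMap.pi fun k =>
    if h : k ≠ i ∧ k ≠ k₀ then LinearMap.proj (⟨k, h⟩ : Others i k₀)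
    else if k = i then 0 else -∑ l, LinearMap.proj l

lemma balancedExtension_self (k₀ : Fin m) (c : Others i k₀ → ℝ) :
    balancedExtension i k₀ c i = 0 := by
  simp [balancedExtension]

lemma balancedExtension_val {k₀ : Fin m} (c : Others i k₀ → ℝ) (k : Others i k₀) :
    balancedExtension i k₀ c k.1 = c k := by
  simp [balancedExtension, k.2.1, k.2.2]

lemma sum_balancedExtension {k₀ : Fin m} (hk₀ : k₀ ≠ i) (c : Others i k₀ → ℝ) :
    ∑ k, balancedExtension i k₀ c k = 0 := by
  have h0 : balancedExtension i k₀ c k₀ = -∑ l, c l := by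
    simp [balancedExtension, hk₀]
  have h1 : ∑ k ∈ (Finset.univ.erase i).erase k₀, balancedExtension i k₀ c k = ∑ l, c l := by
    rw [Finset.sum_subtype (p := fun k => k ≠ i ∧ k ≠ k₀) _ (by simp [and_comm])]
    exact Finset.sum_congr rfl fun k _ => balancedExtension_val c k
  rw [← Finset.add_sum_erase _ _ (Finset.mem_univ i), balancedExtension_self,
    ← Finset.add_sum_erase _ _ (Finset.mem_erase.2 ⟨hk₀, Finset.mem_univ k₀⟩), h0, h1]
  ring

lemma le_card_pos (hm : 3 ≤ m)
    (hD : ∀ S T, D S T = 3 / 2 - sgn i S * sgn i T * (∑ k, inc k S * inc k T - 1 / 2))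
    {ℓ : Pairs m → ℝ} (hF : (FMat D ℓ).IsHermitian) {k₀ : Fin m} (hk₀ : k₀ ≠ i) :
    m - 2 ≤ Nat.card {S // 0 < 1 * hF.eigenvalues S} := by
  rw [← card_others hk₀]
  refine le_card_eigenvalues hF 1 (signedSection i ∘ₗ balancedExtension i k₀) fun c hc => ?_
  have hz : ∑ k, balancedExtension i k₀ c k = 4 * balancedExtension i k₀ c i := by
    rw [sum_balancedExtension hk₀, balancedExtension_self, mul_zero]
  rw [LinearMap.comp_apply, quadratic_FMat_signedSection hm hD ℓ hz, balancedExtension_self]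
  obtain ⟨k, hk⟩ := Function.ne_iff.1 hc
  have h : 0 < ∑ k, balancedExtension i k₀ c k ^ 2 := by
    refine Finset.sum_pos' (fun _ _ => sq_nonneg _) ⟨k.1, Finset.mem_univ _, ?_⟩
    rw [balancedExtension_val]
    exact sq_pos_of_ne_zero hk
  simpa using h

lemma card_neg_le
    (hD : ∀ S T, D S T = 3 / 2 - sgn i S * sgn i T * (∑ k, inc k S * inc k T - 1 / 2))
    {ℓ : Pairs m → ℝ} (hℓ : ∑ S, ℓ S = 1) (hF : (FMat D ℓ).IsHermitian) :
    Nat.card {S // 0 < -1 * hF.eigenvalues S} ≤ 1 := by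
  refine card_eigenvalues_le (κ := Unit) hF (-1)
    ((LinearMap.pi fun _ => LinearMap.proj i) ∘ₗ projectedSum i ℓ) fun x hx => ?_
  have h0 : projectedSum i ℓ x i = 0 := congrFun hx ()
  rw [quadratic_FMat_eq hD hℓ, h0]
  have : 0 ≤ ∑ k, projectedSum i ℓ x k ^ 2 := Finset.sum_nonneg fun _ _ => sq_nonneg _
  linarith

lemma le_card_neg (hm : 11 ≤ m)
    (hD : ∀ S T, D S T = 3 / 2 - sgn i S * sgn i T * (∑ k, inc k S * inc k T - 1 / 2))
    {ℓ : Pairs m → ℝ} (hF : (FMat D ℓ).IsHermitian) :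
    1 ≤ Nat.card {S // 0 < -1 * hF.eigenvalues S} := by
  have hm' : (11 : ℝ) ≤ m := by exact_mod_cast hm
  let v : Fin m → ℝ := fun k => if k = i then ((m : ℝ) - 1) / 3 else 1
  refine le_card_eigenvalues (κ := Unit) hF (-1)
    (signedSection i ∘ₗ (LinearMap.proj ()).smulRight v) fun c hc => ?_
  have hcard : ((Finset.univ.erase i).card : ℝ) = m - 1 := by
    rw [Finset.card_erase_of_mem (Finset.mem_univ _), Finset.card_fin, Nat.cast_sub (by omega)]
    simp
  have hc0 : c () ≠ 0 := fun h => hc (funext fun _ => h)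
  have hvi : v i = ((m : ℝ) - 1) / 3 := if_pos rfl
  have hv : ∀ k ∈ Finset.univ.erase i, v k = 1 := fun k hk => if_neg (Finset.ne_of_mem_erase hk)
  have hsum : ∑ k, v k = 4 * v i := by
    rw [← Finset.add_sum_erase _ _ (Finset.mem_univ i), Finset.sum_congr rfl hv,
      Finset.sum_const, nsmul_eq_mul, hcard, hvi]
    ring
  have hsq : ∑ k, v k ^ 2 = v i ^ 2 + (m - 1) := by
    rw [← Finset.add_sum_erase _ _ (Finset.mem_univ i),
      Finset.sum_congr rfl fun k hk => by rw [hv k hk],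
      Finset.sum_const, nsmul_eq_mul, hcard]
    ring
  have hz : ∑ k, (c () • v) k = 4 * (c () • v) i := by
    simp only [Pi.smul_apply, smul_eq_mul, ← Finset.mul_sum, hsum]
    ring
  rw [LinearMap.comp_apply, LinearMap.smulRight_apply, LinearMap.proj_apply,
    quadratic_FMat_signedSection (by omega) hD ℓ hz]
  simp only [Pi.smul_apply, smul_eq_mul, mul_pow, ← Finset.mul_sum, hsq, hvi]
  have : 0 < c () ^ 2 * (((m : ℝ) - 1) * (m - 10)) :=
    mul_pos (sq_pos_of_ne_zero hc0) (mul_pos (by linarith) (by linarith))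
  nlinarith

end Signature

/-- let `m ≥ 11`, `G = J(m,2)` the Johnson graph on `n = m(m−1)/2`
vertices, and `U = U_i = {S : i ∈ S}` a Delsarte clique.  Let `D' = A' + 2Ā'` be the
dissimilarity matrix (distances `a = 1`, `b = 2`) of the Seidel switch of `G` with
respect to `U`.  Then for every `ℓ` with `ℓᵀ j = 1`, the signature of `F_{D'}(ℓ)`
is `(m − 2, 1)`. -/
theorem stmt16 (m : ℕ) (hm : 11 ≤ m) (i : Fin m)
    (U : Finset {S : Finset (Fin m) // S.card = 2})
    (hU : ∀ S, S ∈ U ↔ i ∈ S.1)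
    (A' : Matrix {S : Finset (Fin m) // S.card = 2} {S : Finset (Fin m) // S.card = 2} ℝ)
    (hA'01 : ∀ S T, A' S T = 0 ∨ A' S T = 1)
    (hA'diag : ∀ S, A' S S = 0) (hA'sym : A'.IsSymm)
    (hA' : A' - (Jmat _ - 1 - A') =
      switchMat U * (johnsonA m - (Jmat _ - 1 - johnsonA m)) * switchMat U)
    (D' : Matrix {S : Finset (Fin m) // S.card = 2} {S : Finset (Fin m) // S.card = 2} ℝ)
    (hD' : D' = A' + (2 : ℝ) • (Jmat _ - 1 - A')) :
    Fintype.card {S : Finset (Fin m) // S.card = 2} = m * (m - 1) / 2 ∧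
    ∀ ℓ, ∑ S, ℓ S = 1 → signature (FMat D' ℓ) = (m - 2, 1) := by
  have hDf : ∀ S T, D' S T = 3 / 2 - sgn i S * sgn i T * (∑ k, inc k S * inc k T - 1 / 2) :=
    hD' ▸ switched_dissimilarity_apply i U hU hA'
  have hsym : D'.IsSymm := by
    ext S T
    rw [transpose_apply, hDf, hDf]
    simp only [mul_comm]
  refine ⟨by simp [Nat.choose_two_right], fun ℓ hℓ => ?_⟩
  obtain ⟨k₀, hk₀⟩ : ∃ k₀ : Fin m, k₀ ≠ i := by
    have : Nontrivial (Fin m) := Fin.nontrivial_iff_two_le.2 (by omega)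
    exact exists_ne i
  have hF := isHermitian_FMat hsym ℓ
  have hp := le_antisymm (card_pos_le hm hDf hℓ hF hk₀) (le_card_pos (by omega) hDf hF hk₀)
  have hn := le_antisymm (card_neg_le hDf hℓ hF) (le_card_neg hm hDf hF)
  simp only [one_mul] at hp
  simp only [neg_mul, one_mul, Left.neg_pos_iff] at hn
  rw [signature, sigP, sigN, dif_pos hF, dif_pos hF, hp, hn]
end

section
/- Let m = 10, let G = J(10,2) be the Johnson graph with vertex set V of size 45, and let U = U_i be a Delsarte clique. Let D' = A' + 2Ā' be the dissimilarity matrix with distances a = 1, b = 2 of the graph obtained from G by Seidel switching with respect to U. Then for every ℓ ∈ ℝ^V with ℓᵀ j = 1, the signature of F_{D'}(ℓ) is (8, 0); in particular the switched graph admits a representation as a 2-distance set of 45 points in Euclidean space ℝ^8. -/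
open Matrix

/-- A matrix of the form `B Bᵀ` has signature `(rank B, 0)`. -/
theorem signature_mul_transpose {V n : Type*} [Fintype V] [DecidableEq V] [Fintype n]
    (B : Matrix V n ℝ) : signature (B * Bᵀ) = (B.rank, 0) := by
  have hps : (B * Bᵀ).PosSemidef := by
    simpa [Matrix.conjTranspose_eq_transpose_of_trivial] using
      Matrix.posSemidef_self_mul_conjTranspose B
  have hH := hps.isHermitian
  have hnn := hps.eigenvalues_nonneg
  have hr : (B * Bᵀ).rank = B.rank := Matrix.rank_self_mul_transpose B
  rw [hH.rank_eq_card_non_zero_eigs] at hr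
  unfold signature sigP sigN
  rw [dif_pos hH, dif_pos hH]
  refine Prod.ext ?_ ?_
  · rw [← hr, ← Nat.card_eq_fintype_card]
    exact Nat.card_congr (Equiv.subtypeEquivRight fun i =>
      ⟨fun h => h.ne', fun h => lt_of_le_of_ne (hnn i) (Ne.symm h)⟩)
  · have : IsEmpty {i // hH.eigenvalues i < 0} := ⟨fun x => absurd x.2 (not_lt.mpr (hnn x.1))⟩
    simp

/-- If the entries of `D` are half the squared distances between the rows of `W`, then
`F_D(ℓ)` is the Gram matrix of the rows of `W` translated by their `ℓ`-barycentre. -/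
theorem fMat_eq_mul_transpose {V n : Type*} [Fintype V] [DecidableEq V] [Fintype n]
    (D : Matrix V V ℝ) (W : Matrix V n ℝ) (hD : ∀ S T, ∑ j, (W S j - W T j) ^ 2 = 2 * D S T)
    (ℓ : V → ℝ) (hℓ : ∑ S, ℓ S = 1) :
    FMat D ℓ = ((1 - vecMulVec (fun _ => 1) ℓ) * W) * ((1 - vecMulVec (fun _ => 1) ℓ) * W)ᵀ := by
  set q : V → ℝ := fun S => (∑ j, W S j ^ 2) / 2
  set P : Matrix V V ℝ := 1 - vecMulVec (fun _ => 1) ℓ with hP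
  have hPt : (1 - vecMulVec ℓ (fun _ => 1) : Matrix V V ℝ) = Pᵀ := by
    rw [hP, Matrix.transpose_sub, Matrix.transpose_one, Matrix.transpose_vecMulVec]
  have hdecomp : D = vecMulVec q (fun _ => 1) + vecMulVec (fun _ => 1) q - W * Wᵀ := by
    ext S T
    have h : ∑ j, (W S j - W T j) ^ 2
        = ∑ j, W S j ^ 2 + ∑ j, W T j ^ 2 - 2 * ∑ j, W S j * W T j := by
      rw [Finset.mul_sum, ← Finset.sum_add_distrib, ← Finset.sum_sub_distrib]
      exact Finset.sum_congr rfl fun j _ => by ring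
    have := hD S T
    simp only [q, Matrix.sub_apply, Matrix.add_apply, vecMulVec_apply, Matrix.mul_apply,
      Matrix.transpose_apply]
    linarith
  have hP1 : P *ᵥ (fun _ => 1) = 0 := by
    ext S
    simp [hP, Matrix.sub_mulVec, Matrix.vecMulVec_mulVec, dotProduct, hℓ]
  have h1P : (fun _ => 1) ᵥ* Pᵀ = 0 := by rw [Matrix.vecMul_transpose, hP1]
  unfold FMat
  rw [hPt, ← hP, hdecomp, Matrix.mul_sub, Matrix.mul_add, Matrix.sub_mul, Matrix.add_mul,
    Matrix.mul_assoc P (vecMulVec q _), Matrix.vecMulVec_mul, h1P, Matrix.mul_vecMulVec P _ q, hP1,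
    Matrix.transpose_mul]
  simp [Matrix.mul_assoc]

/-- The indicator of `S`, reflected to `1/3 - 1_S` when `i ∈ S`, on the nine points other
than `i`. -/
noncomputable def switchedIndicator (i : Fin 10) (S : Finset (Fin 10)) (a : Fin 9) : ℝ :=
  if i ∈ S then 1 / 3 - (if i.succAbove a ∈ S then 1 else 0)
  else if i.succAbove a ∈ S then 1 else 0

/-- The image of `switchedIndicator` under the linear map `ℝ⁹ → ℝ⁸` sending the first eight basis
vectors to the standard basis and the last one to `(1/2, …, 1/2)`. -/
noncomputable def switchedPoint (i : Fin 10) (S : Finset (Fin 10)) (j : Fin 8) : ℝ :=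
  switchedIndicator i S j.castSucc + switchedIndicator i S (Fin.last 8) / 2

/-- The linear map `ℝ⁹ → ℝ⁸` underlying `switchedPoint` is isometric on the vectors with
coordinate sum zero. -/
theorem sum_sq_simplexMap (x : Fin 9 → ℝ) (hx : ∑ a, x a = 0) :
    ∑ j : Fin 8, (x j.castSucc + x (Fin.last 8) / 2) ^ 2 = ∑ a, x a ^ 2 := by
  rw [Fin.sum_univ_castSucc] at hx
  rw [Fin.sum_univ_castSucc (fun a => x a ^ 2)]
  have h : ∑ j : Fin 8, (x j.castSucc + x (Fin.last 8) / 2) ^ 2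
      = ∑ j : Fin 8, x j.castSucc ^ 2 + x (Fin.last 8) * ∑ j : Fin 8, x j.castSucc
        + 2 * x (Fin.last 8) ^ 2 := by
    simp only [add_sq, Finset.sum_add_distrib, Finset.mul_sum]
    simp only [Finset.sum_const, Finset.card_univ, Fintype.card_fin, nsmul_eq_mul]
    congr 1
    · congr 1
      exact Finset.sum_congr rfl fun j _ => by ring
    · push_cast; ring
  rw [h]
  linear_combination x (Fin.last 8) * hx

/-- The sum of the indicator of `S` over the points other than `i`. -/
theorem sum_indicator {i : Fin 10} (S : Finset (Fin 10)) :
    ∑ a, (if i.succAbove a ∈ S then (1 : ℝ) else 0) = S.card - if i ∈ S then 1 else 0 := by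
  have h := Fin.sum_univ_succAbove (fun k => if k ∈ S then (1 : ℝ) else 0) i
  simp only [Finset.sum_ite_mem, Finset.univ_inter, Finset.sum_const, nsmul_eq_mul, mul_one] at h
  linarith

theorem sum_switchedIndicator {i : Fin 10} {S : Finset (Fin 10)} (hS : S.card = 2) :
    ∑ a, switchedIndicator i S a = 2 := by
  have h := sum_indicator (i := i) S
  by_cases hi : i ∈ S
  · simp only [switchedIndicator, hi, if_true, Finset.sum_sub_distrib] at h ⊢
    rw [h, hS]; norm_num
  · simp only [switchedIndicator, hi, if_false] at h ⊢
    rw [h, hS]; norm_num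

/-- Squared distances between the points `switchedPoint i S`. -/
theorem sum_sq_switchedPoint_sub {i : Fin 10} {S T : Finset (Fin 10)} (hS : S.card = 2)
    (hT : T.card = 2) :
    ∑ j, (switchedPoint i S j - switchedPoint i T j) ^ 2 =
      if (i ∈ S ↔ i ∈ T) then 4 - 2 * ((S ∩ T).card : ℝ) else 2 + 2 * ((S ∩ T).card : ℝ) := by
  have hiso := sum_sq_simplexMap (fun a => switchedIndicator i S a - switchedIndicator i T a)
    (by rw [Finset.sum_sub_distrib, sum_switchedIndicator hS, sum_switchedIndicator hT, sub_self])
  have hl : ∑ j, (switchedPoint i S j - switchedPoint i T j) ^ 2 =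
      ∑ a, (switchedIndicator i S a - switchedIndicator i T a) ^ 2 := by
    rw [← hiso]
    exact Finset.sum_congr rfl fun j _ => by unfold switchedPoint; ring
  have hs := sum_indicator (i := i) S
  have ht := sum_indicator (i := i) T
  have hst := sum_indicator (i := i) (S ∩ T)
  rw [hS] at hs
  rw [hT] at ht
  have hsame : ∀ a, ((if i.succAbove a ∈ S then (1 : ℝ) else 0)
      - (if i.succAbove a ∈ T then 1 else 0)) ^ 2 = (if i.succAbove a ∈ S then 1 else 0)
        + (if i.succAbove a ∈ T then 1 else 0) - 2 * (if i.succAbove a ∈ S ∩ T then 1 else 0) := by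
    intro a
    by_cases h1 : i.succAbove a ∈ S <;> by_cases h2 : i.succAbove a ∈ T <;> simp [h1, h2]
    norm_num
  have hmixed : ∀ a, ((if i.succAbove a ∈ S then (1 : ℝ) else 0)
      + (if i.succAbove a ∈ T then 1 else 0) - 1 / 3) ^ 2
      = 1 / 3 * (if i.succAbove a ∈ S then 1 else 0)
        + 1 / 3 * (if i.succAbove a ∈ T then 1 else 0)
        + 2 * (if i.succAbove a ∈ S ∩ T then 1 else 0) + 1 / 9 := by
    intro a
    by_cases h1 : i.succAbove a ∈ S <;> by_cases h2 : i.succAbove a ∈ T <;> simp [h1, h2] <;>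
      norm_num
  have hsame' := Finset.sum_congr (rfl : (Finset.univ : Finset (Fin 9)) = Finset.univ)
    fun a _ => hsame a
  have hmixed' := Finset.sum_congr (rfl : (Finset.univ : Finset (Fin 9)) = Finset.univ)
    fun a _ => hmixed a
  simp only [Finset.sum_add_distrib, Finset.sum_sub_distrib, ← Finset.mul_sum] at hsame' hmixed'
  simp only [Finset.sum_const, Finset.card_univ, Fintype.card_fin, nsmul_eq_mul] at hmixed'
  rw [hs, ht, hst] at hsame' hmixed'
  rw [hl]
  unfold switchedIndicator
  by_cases h1 : i ∈ S <;> by_cases h2 : i ∈ T <;>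
    simp only [h1, h2, if_true, if_false, Finset.mem_inter, and_true, and_false, iff_true,
      iff_false, not_true] at hsame' hmixed' ⊢
  · rw [Finset.sum_congr rfl fun a _ => sub_sq_comm _ _]
    simp only [sub_sub_sub_cancel_left]
    push_cast at hsame'
    linarith
  · refine Eq.trans (Eq.trans (Finset.sum_congr rfl fun a _ => by ring) hmixed') ?_
    push_cast; ring
  · refine Eq.trans (Eq.trans (Finset.sum_congr rfl fun a _ => by ring) hmixed') ?_
    push_cast; ring
  · push_cast at hsame'
    linarith

/-- The points `switchedPoint i S` affinely span `ℝ⁸`. -/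
theorem eq_zero_of_dotProduct_switchedPoint {i : Fin 10} {v : Fin 8 → ℝ} {c : ℝ}
    (h : ∀ S : Finset (Fin 10), S.card = 2 → ∑ j, switchedPoint i S j * v j = c) : v = 0 := by
  have hmem : ∀ a b : Fin 9,
      (i.succAbove b ∈ ({i, i.succAbove a} : Finset (Fin 10))) ↔ b = a := by
    intro a b
    simp [Fin.succAbove_ne]
  have key : ∀ a : Fin 9, ∑ j : Fin 8, ((1 / 3 - (if j.castSucc = a then (1 : ℝ) else 0))
      + (1 / 3 - (if Fin.last 8 = a then (1 : ℝ) else 0)) / 2) * v j = c := by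
    intro a
    have := h {i, i.succAbove a} (Finset.card_pair (Fin.succAbove_ne i a).symm)
    simpa only [switchedPoint, switchedIndicator, hmem, Finset.mem_insert_self, if_true] using this
  have hc : c = 0 := by
    have := key (Fin.last 8)
    simp only [Fin.castSucc_ne_last, if_true, if_false] at this
    rw [← this]
    exact Finset.sum_eq_zero fun j _ => by ring
  have hv : ∀ k, v k = (∑ j, v j) / 2 := by
    intro k
    have := key k.castSucc
    simp only [Fin.castSucc_inj, (Fin.castSucc_ne_last k).symm, if_false] at this
    have h2 : ∀ j, ((1 / 3 - (if j = k then (1 : ℝ) else 0)) + (1 / 3 - 0) / 2) * v j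
        = 1 / 2 * v j - if j = k then v j else 0 := by
      intro j
      split_ifs <;> ring
    simp only [h2, Finset.sum_sub_distrib, ← Finset.mul_sum, Finset.sum_ite_eq',
      Finset.mem_univ, if_true] at this
    linarith
  have hsum : ∑ j, v j = 8 * ((∑ j, v j) / 2) := by
    conv_lhs => rw [Finset.sum_congr rfl fun k _ => hv k]
    simp
  ext k
  rw [hv k, Pi.zero_apply]
  linarith

/-- let `m = 10`, `G = J(10,2)` the Johnson graph on `45` vertices, and
`U = U_i = {S : i ∈ S}` a Delsarte clique.  Let `D' = A' + 2Ā'` be the dissimilarity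
matrix (distances `a = 1`, `b = 2`) of the Seidel switch of `G` with respect to `U`.
Then for every `ℓ` with `ℓᵀ j = 1`, the signature of `F_{D'}(ℓ)` is `(8, 0)`; in
particular the switched graph admits a representation as a 2-distance set of `45`
points in Euclidean space `ℝ^8`. -/
theorem stmt17 (i : Fin 10)
    (U : Finset {S : Finset (Fin 10) // S.card = 2})
    (hU : ∀ S, S ∈ U ↔ i ∈ S.1)
    (A' : Matrix {S : Finset (Fin 10) // S.card = 2} {S : Finset (Fin 10) // S.card = 2} ℝ)
    (hA'01 : ∀ S T, A' S T = 0 ∨ A' S T = 1)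
    (hA'diag : ∀ S, A' S S = 0) (hA'sym : A'.IsSymm)
    (hA' : A' - (Jmat _ - 1 - A') =
      switchMat U * (johnsonA 10 - (Jmat _ - 1 - johnsonA 10)) * switchMat U)
    (D' : Matrix {S : Finset (Fin 10) // S.card = 2} {S : Finset (Fin 10) // S.card = 2} ℝ)
    (hD' : D' = A' + (2 : ℝ) • (Jmat _ - 1 - A')) :
    Fintype.card {S : Finset (Fin 10) // S.card = 2} = 45 ∧
    (∀ ℓ, ∑ S, ℓ S = 1 → signature (FMat D' ℓ) = (8, 0)) ∧
    ∃ (x : {S : Finset (Fin 10) // S.card = 2} → (Fin 8 → ℝ)) (α β : ℝ),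
      Function.Injective x ∧ α ≠ β ∧
      ∀ S T, S ≠ T →
        (∑ j, (x S j - x T j) ^ 2) = (if A' S T = 1 then α else β) := by
  have hent : ∀ S T, S ≠ T → A' S T =
      (1 + (if S ∈ U then -1 else 1) * (2 * johnsonA 10 S T - 1) * (if T ∈ U then -1 else 1)) / 2 := by
    intro S T hST
    have h := congrFun (congrFun hA' S) T
    simp only [switchMat, Jmat, Matrix.mul_diagonal, Matrix.diagonal_mul, Matrix.sub_apply,
      Matrix.of_apply, Matrix.one_apply_ne hST] at h
    linarith
  have hdist : ∀ S T, S ≠ T → ∑ j, (switchedPoint i S.1 j - switchedPoint i T.1 j) ^ 2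
      = 2 * (2 - A' S T) := by
    intro S T hST
    have hn : (S.1 ∩ T.1).card = 0 ∨ (S.1 ∩ T.1).card = 1 := by
      have hle : (S.1 ∩ T.1).card ≤ 2 :=
        (Finset.card_le_card Finset.inter_subset_left).trans S.2.le
      have hne : (S.1 ∩ T.1).card ≠ 2 := by
        intro h2
        have e1 := Finset.eq_of_subset_of_card_le (Finset.inter_subset_left (s₁ := S.1) (s₂ := T.1))
          (by rw [h2, S.2])
        have e2 := Finset.eq_of_subset_of_card_le (Finset.inter_subset_right (s₁ := S.1) (s₂ := T.1))
          (by rw [h2, T.2])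
        exact hST (Subtype.ext (e1.symm.trans e2))
      omega
    rw [sum_sq_switchedPoint_sub S.2 T.2, hent S T hST]
    simp only [hU, johnsonA, Matrix.of_apply]
    by_cases h1 : i ∈ S.1 <;> by_cases h2 : i ∈ T.1 <;> rcases hn with hn | hn <;>
      simp [h1, h2, hn] <;> norm_num
  have hD : ∀ S T, ∑ j, (switchedPoint i S.1 j - switchedPoint i T.1 j) ^ 2 = 2 * D' S T := by
    intro S T
    by_cases hST : S = T
    · subst hST
      simp [hD', Jmat, hA'diag]
    · rw [hdist S T hST, hD']
      simp only [Jmat, Matrix.add_apply, Matrix.smul_apply, Matrix.sub_apply, Matrix.of_apply,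
        Matrix.one_apply_ne hST, smul_eq_mul]
      ring
  refine ⟨?_, ?_, fun S => switchedPoint i S.1, 2, 4, ?_, by norm_num, ?_⟩
  · rw [Fintype.card_finset_len, Fintype.card_fin]
    decide
  · intro ℓ hℓ
    rw [fMat_eq_mul_transpose D' (Matrix.of fun S j => switchedPoint i S.1 j) hD ℓ hℓ,
      signature_mul_transpose]
    congr 1
    rw [Matrix.rank, LinearMap.finrank_range_of_inj, Module.finrank_fin_fun]
    rw [← LinearMap.ker_eq_bot, LinearMap.ker_eq_bot']
    intro v hv
    rw [Matrix.mulVecLin_apply, ← Matrix.mulVec_mulVec, Matrix.sub_mulVec, Matrix.one_mulVec,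
      Matrix.vecMulVec_mulVec, sub_eq_zero] at hv
    refine eq_zero_of_dotProduct_switchedPoint (i := i)
      (c := ℓ ⬝ᵥ (Matrix.of fun S j => switchedPoint i S.1 j) *ᵥ v) fun S hS => ?_
    simpa only [Matrix.mulVec, dotProduct, Matrix.of_apply, Pi.smul_apply,
      MulOpposite.smul_eq_mul_unop, MulOpposite.unop_op, one_mul] using congrFun hv ⟨S, hS⟩
  · intro S T h
    by_contra hST
    have h0 := hdist S T hST
    have h1 : ∀ j, switchedPoint i S.1 j = switchedPoint i T.1 j := congrFun h
    simp only [h1, sub_self] at h0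
    rcases hA'01 S T with h2 | h2 <;> rw [h2] at h0 <;> norm_num at h0
  · intro S T hST
    rw [hdist S T hST]
    rcases hA'01 S T with h2 | h2 <;> rw [h2] <;> norm_num
end

section
/- Let m ≥ 5, let G = H(2,m) be the Hamming graph with vertex set V of size m², let I ⊆ {1,…,m} with |I| = s ≤ ⌊m/2⌋, and let U = ⋃_{i∈I} U_i be the disjoint union of s Delsarte cliques of the same type (or symmetrically U = ⋃_{i∈I} V_i). Let D' = A' + 2Ā' be the dissimilarity matrix with distances a = 1, b = 2 of the graph obtained from G by Seidel switching with respect to U, and set t_m = (m/2)(1 − √((m − 4)/(m − 2))). Then for every ℓ ∈ ℝ^V with ℓᵀ j = 1: if 0 ≤ s < t_m, the signature of F_{D'}(ℓ) is (2m − 2, 0); and if t_m < s ≤ ⌊m/2⌋, the signature of F_{D'}(ℓ) is (2m − 3, 1). -/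
open Matrix

/-- The adjacency matrix of the Hamming graph `H(2,m)`: vertices are the pairs in
`{1,…,m} × {1,…,m}`, two distinct vertices adjacent iff they agree in exactly one
coordinate. -/
noncomputable def hammingA (m : ℕ) : Matrix (Fin m × Fin m) (Fin m × Fin m) ℝ :=
  Matrix.of fun p q => if p ≠ q ∧ (p.1 = q.1 ∨ p.2 = q.2) then 1 else 0

lemma Matrix.IsHermitian.dotProduct_mulVec_eq_sum_eigenvalues {n : Type*} [Fintype n]
    [DecidableEq n] {M : Matrix n n ℝ} (h : M.IsHermitian) (x : n → ℝ) :
    x ⬝ᵥ M *ᵥ x =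
      ∑ i, h.eigenvalues i * ((star (h.eigenvectorUnitary : Matrix n n ℝ)) *ᵥ x) i ^ 2 := by
  set P : Matrix n n ℝ := (h.eigenvectorUnitary : Matrix n n ℝ)
  have hM : M = P * diagonal h.eigenvalues * star P := by
    have := h.spectral_theorem
    rw [Unitary.conjStarAlgAut_apply] at this
    exact this
  have hx : x ᵥ* P = star P *ᵥ x := by
    rw [star_eq_conjTranspose, conjTranspose_eq_transpose_of_trivial, mulVec_transpose]
  calc x ⬝ᵥ M *ᵥ x = x ⬝ᵥ (P * diagonal h.eigenvalues * star P) *ᵥ x := by rw [← hM]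
    _ = (star P *ᵥ x) ⬝ᵥ diagonal h.eigenvalues *ᵥ (star P *ᵥ x) := by
      rw [← mulVec_mulVec, ← mulVec_mulVec, dotProduct_mulVec, hx]
    _ = _ := by
      simp only [dotProduct, mulVec_diagonal]
      exact Finset.sum_congr rfl fun i _ => by ring

lemma Matrix.IsHermitian.finrank_le_card_eigenvalues {n : Type*} [Fintype n]
    [DecidableEq n] {M : Matrix n n ℝ} (h : M.IsHermitian) (e : ℝ) (W : Submodule ℝ (n → ℝ))
    (hW : ∀ x ∈ W, x ≠ 0 → 0 < e * (x ⬝ᵥ M *ᵥ x)) :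
    Module.finrank ℝ W ≤ Nat.card {i // 0 < e * h.eigenvalues i} := by
  classical
  let L : W →ₗ[ℝ] ({i // 0 < e * h.eigenvalues i} → ℝ) :=
    LinearMap.funLeft ℝ ℝ Subtype.val ∘ₗ
      (star (h.eigenvectorUnitary : Matrix n n ℝ)).mulVecLin ∘ₗ W.subtype
  have hL : Function.Injective L := by
    rw [← LinearMap.ker_eq_bot, LinearMap.ker_eq_bot']
    rintro ⟨x, hx⟩ h0
    by_contra hne
    have hpos := hW x hx fun hx0 => hne (Subtype.ext hx0)
    rw [h.dotProduct_mulVec_eq_sum_eigenvalues, Finset.mul_sum] at hpos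
    refine absurd hpos (not_lt.2 (Finset.sum_nonpos fun i _ => ?_))
    by_cases hi : 0 < e * h.eigenvalues i
    · have : ((star (h.eigenvectorUnitary : Matrix n n ℝ)) *ᵥ x) i = 0 :=
        congrFun h0 ⟨i, hi⟩
      simp [this]
    · rw [← mul_assoc]
      exact mul_nonpos_of_nonpos_of_nonneg (not_lt.1 hi) (sq_nonneg _)
  have := LinearMap.finrank_le_finrank_of_injective hL
  rwa [Module.finrank_fintype_fun_eq_card, ← Nat.card_eq_fintype_card] at this

/-- A quadratic form pulled back along `Φ` from a form that is positive definite on a subspace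
of the range of `Φ` has at least that many positive eigenvalues. -/
lemma finrank_le_sigP {n F : Type*} [Fintype n] [DecidableEq n] [AddCommGroup F] [Module ℝ F]
    {M : Matrix n n ℝ} (h : M.IsHermitian) (Φ : (n → ℝ) →ₗ[ℝ] F) (Q : F → ℝ)
    (hQ : ∀ x, x ⬝ᵥ M *ᵥ x = Q (Φ x)) (e : ℝ) (W : Submodule ℝ F)
    (hWΦ : W ≤ LinearMap.range Φ) (hW : ∀ w ∈ W, w ≠ 0 → 0 < e * Q w) :
    Module.finrank ℝ W ≤ Nat.card {i // 0 < e * h.eigenvalues i} := by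
  obtain ⟨Ψ, hΨ⟩ := Φ.rangeRestrict.exists_rightInverse_of_surjective Φ.range_rangeRestrict
  have hΦΨ : ∀ w, Φ (Ψ w) = w := fun w => congrArg Subtype.val (LinearMap.congr_fun hΨ w)
  let Θ : W →ₗ[ℝ] (n → ℝ) := Ψ ∘ₗ Submodule.inclusion hWΦ
  have hΘ : ∀ w, Φ (Θ w) = w := fun w => hΦΨ _
  have hinj : Function.Injective Θ := fun a b hab =>
    Subtype.ext (by rw [← hΘ a, ← hΘ b, hab])
  rw [← LinearMap.finrank_range_of_inj hinj]
  refine h.finrank_le_card_eigenvalues e _ ?_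
  rintro _ ⟨w, rfl⟩ hne
  rw [hQ, hΘ]
  refine hW w w.2 fun h0 => hne ?_
  rw [Subtype.ext h0 (a2 := (0 : W)), map_zero]

lemma sigP_add_sigN_le {n F : Type*} [Fintype n] [DecidableEq n] [AddCommGroup F] [Module ℝ F]
    {M : Matrix n n ℝ} (h : M.IsHermitian) (Φ : (n → ℝ) →ₗ[ℝ] F) (Q : F → ℝ)
    (hQ : ∀ x, x ⬝ᵥ M *ᵥ x = Q (Φ x)) :
    sigP M + sigN M ≤ Module.finrank ℝ (LinearMap.range Φ) := by
  classical
  have hker : LinearMap.ker Φ ≤ LinearMap.ker M.mulVecLin := by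
    intro x hx
    rw [LinearMap.mem_ker] at hx
    have hxx : x ⬝ᵥ M *ᵥ x = 0 := by
      have h0 := hQ 0
      rw [hQ, hx]
      rw [map_zero] at h0
      rw [← h0]; simp
    rw [LinearMap.mem_ker, mulVecLin_apply]
    refine dotProduct_eq_zero _ fun y => ?_
    have h1 := hQ (x + y)
    have hsym : x ⬝ᵥ M *ᵥ y = y ⬝ᵥ M *ᵥ x := by
      have hT : Mᵀ = M := by rw [← conjTranspose_eq_transpose_of_trivial]; exact h
      rw [dotProduct_mulVec, ← mulVec_transpose, hT, dotProduct_comm]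
    rw [map_add, hx, zero_add, ← hQ, mulVec_add, add_dotProduct, dotProduct_add,
      dotProduct_add, hxx, hsym] at h1
    rw [dotProduct_comm]
    linarith
  have hrank : M.rank ≤ Module.finrank ℝ (LinearMap.range Φ) := by
    have h1 := LinearMap.finrank_range_add_finrank_ker Φ
    have h2 := LinearMap.finrank_range_add_finrank_ker M.mulVecLin
    have h3 := Submodule.finrank_mono hker
    unfold Matrix.rank
    omega
  rw [h.rank_eq_card_non_zero_eigs] at hrank
  refine le_trans (le_of_eq ?_) hrank
  rw [sigP, sigN, dif_pos h, dif_pos h, Nat.card_eq_fintype_card, Nat.card_eq_fintype_card,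
    Fintype.card_subtype, Fintype.card_subtype, Fintype.card_subtype,
    ← Finset.card_union_of_disjoint]
  · congr 1
    ext i
    simp [lt_or_lt_iff_ne, eq_comm]
  · rw [Finset.disjoint_filter]
    intro i _ h1 h2
    linarith

/-- The sign `−1` on `I` and `+1` off `I`. -/
noncomputable def indexSign {m : ℕ} (I : Finset (Fin m)) (i : Fin m) : ℝ :=
  if i ∈ I then -1 else 1

lemma indexSign_mul_self {m : ℕ} (I : Finset (Fin m)) (i : Fin m) :
    indexSign I i * indexSign I i = 1 := by
  unfold indexSign; split_ifs <;> norm_num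

lemma sum_indexSign_mul {m : ℕ} (I : Finset (Fin m)) (f : Fin m → ℝ) :
    ∑ i, indexSign I i * f i = ∑ i ∈ Iᶜ, f i - ∑ i ∈ I, f i := by
  rw [← Finset.sum_add_sum_compl I, add_comm, sub_eq_add_neg, ← Finset.sum_neg_distrib]
  congr 1
  · exact Finset.sum_congr rfl fun i hi => by
      simp [indexSign, Finset.mem_compl.1 hi]
  · exact Finset.sum_congr rfl fun i hi => by simp [indexSign, hi]

/-- The row sums and column sums of `ε y`, where `y = x − (jᵀ x) ℓ`, the sign `ε` is that of the
first coordinate, and the array `y` is read through the reindexing `e`. -/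
noncomputable def signedMarginals {m : ℕ} (I : Finset (Fin m))
    (e : Fin m × Fin m ≃ Fin m × Fin m) (ℓ : Fin m × Fin m → ℝ) :
    (Fin m × Fin m → ℝ) →ₗ[ℝ] (Fin m → ℝ) × (Fin m → ℝ) where
  toFun x :=
    (fun i => ∑ k, indexSign I i * (x (e (i, k)) - (∑ p, x p) * ℓ (e (i, k))),
      fun k => ∑ i, indexSign I i * (x (e (i, k)) - (∑ p, x p) * ℓ (e (i, k))))
  map_add' x y := by
    refine Prod.ext (funext fun i => ?_) (funext fun i => ?_) <;>
      simp only [Prod.fst_add, Prod.snd_add, Pi.add_apply, ← Finset.sum_add_distrib] <;>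
      refine Finset.sum_congr rfl fun k _ => ?_ <;>
      rw [Finset.sum_add_distrib] <;> ring
  map_smul' c x := by
    have hs : ∑ p, c * x p = c * ∑ p, x p := (Finset.mul_sum ..).symm
    refine Prod.ext (funext fun i => ?_) (funext fun i => ?_) <;>
      simp only [Prod.smul_fst, Prod.smul_snd, Pi.smul_apply, smul_eq_mul, RingHom.id_apply,
        hs] <;>
      refine Eq.trans ?_ (Finset.mul_sum ..).symm <;>
      refine Finset.sum_congr rfl fun k _ => ?_ <;> ring

/-- The two linear constraints satisfied by `signedMarginals`: equal totals, and vanishing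
signed total of the first component. -/
noncomputable def marginalConstraints {m : ℕ} (I : Finset (Fin m)) :
    (Fin m → ℝ) × (Fin m → ℝ) →ₗ[ℝ] ℝ × ℝ where
  toFun p := (∑ i, p.1 i - ∑ i, p.2 i, ∑ i, indexSign I i * p.1 i)
  map_add' p q := by
    refine Prod.ext ?_ ?_ <;> simp [Finset.sum_add_distrib, mul_add]
    ring
  map_smul' c p := by
    refine Prod.ext ?_ ?_ <;> simp [Finset.mul_sum, mul_sub]
    exact Finset.sum_congr rfl fun i _ => by ring

lemma mem_ker_marginalConstraints {m : ℕ} (I : Finset (Fin m)) (p : (Fin m → ℝ) × (Fin m → ℝ)) :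
    p ∈ LinearMap.ker (marginalConstraints I) ↔
      ∑ i, p.1 i = ∑ i, p.2 i ∧ ∑ i, indexSign I i * p.1 i = 0 := by
  rw [LinearMap.mem_ker, Prod.ext_iff]
  exact and_congr_left' sub_eq_zero

lemma finrank_ker_marginalConstraints {m : ℕ} (I : Finset (Fin m)) {i₀ : Fin m} (hi₀ : i₀ ∉ I) :
    Module.finrank ℝ (LinearMap.ker (marginalConstraints I)) = 2 * m - 2 := by
  have hsurj : LinearMap.range (marginalConstraints I) = ⊤ := by
    rw [LinearMap.range_eq_top]
    rintro ⟨u, v⟩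
    refine ⟨(Pi.single i₀ v, Pi.single i₀ (v - u)), ?_⟩
    refine Prod.ext ?_ ?_
    · simp [marginalConstraints]
    · simp [marginalConstraints, Pi.single_apply]
      simp [indexSign, hi₀]
  have h := LinearMap.finrank_range_add_finrank_ker (marginalConstraints I)
  rw [hsurj, finrank_top] at h
  simp only [Module.finrank_prod, Module.finrank_self, Module.finrank_fin_fun] at h
  omega

lemma range_signedMarginals {m : ℕ} (hm : 0 < m) (I : Finset (Fin m))
    (e : Fin m × Fin m ≃ Fin m × Fin m) (ℓ : Fin m × Fin m → ℝ) (hℓ : ∑ p, ℓ p = 1) :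
    LinearMap.range (signedMarginals I e ℓ) = LinearMap.ker (marginalConstraints I) := by
  have hsum : ∀ f : Fin m × Fin m → ℝ, ∑ i, ∑ k, f (e (i, k)) = ∑ p, f p := fun f => by
    rw [← Fintype.sum_prod_type' (f := fun i k => f (e (i, k)))]
    exact Equiv.sum_comp e f
  apply le_antisymm
  · rintro _ ⟨x, rfl⟩
    rw [mem_ker_marginalConstraints]
    refine ⟨by simp only [signedMarginals, LinearMap.coe_mk, AddHom.coe_mk]; exact Finset.sum_comm,
      ?_⟩
    simp only [signedMarginals, LinearMap.coe_mk, AddHom.coe_mk, Finset.mul_sum, ← mul_assoc,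
      indexSign_mul_self, one_mul]
    rw [hsum (fun p => x p - (∑ q, x q) * ℓ p), Finset.sum_sub_distrib, ← Finset.mul_sum, hℓ]
    ring
  · rintro ⟨R, C⟩ h
    obtain ⟨h1, h2⟩ := (mem_ker_marginalConstraints I _).1 h
    simp only at h1 h2
    have hm' : (m : ℝ) ≠ 0 := by positivity
    let z : Fin m → Fin m → ℝ := fun i k => R i / m + C k / m - (∑ j, C j) / m ^ 2
    have hrow : ∀ i, ∑ k, z i k = R i := fun i => by
      simp only [z, Finset.sum_sub_distrib, Finset.sum_add_distrib, ← Finset.sum_div]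
      simp; field_simp; ring
    have hcol : ∀ k, ∑ i, z i k = C k := fun k => by
      simp only [z, Finset.sum_sub_distrib, Finset.sum_add_distrib, ← Finset.sum_div, h1]
      simp; field_simp; ring
    let x : Fin m × Fin m → ℝ := fun p =>
      indexSign I (e.symm p).1 * z (e.symm p).1 (e.symm p).2
    have hx : ∑ p, x p = 0 := by
      rw [← hsum]
      simp only [x, Equiv.symm_apply_apply, ← Finset.mul_sum, hrow, h2]
    refine ⟨x, Prod.ext (funext fun i => ?_) (funext fun k => ?_)⟩
    · simp only [signedMarginals, LinearMap.coe_mk, AddHom.coe_mk, hx, x,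
        Equiv.symm_apply_apply, zero_mul, sub_zero, ← mul_assoc, indexSign_mul_self, one_mul,
        hrow]
    · simp only [signedMarginals, LinearMap.coe_mk, AddHom.coe_mk, hx, x,
        Equiv.symm_apply_apply, zero_mul, sub_zero, ← mul_assoc, indexSign_mul_self, one_mul,
        hcol]

/-- The quadratic form induced on the row and column sums. -/
noncomputable def marginalForm {m : ℕ} (p : (Fin m → ℝ) × (Fin m → ℝ)) : ℝ :=
  ∑ i, p.1 i ^ 2 + ∑ i, p.2 i ^ 2 - (∑ i, p.1 i) ^ 2 / 2

lemma marginalForm_pos_of_sum_eq_zero {m : ℕ} {p : (Fin m → ℝ) × (Fin m → ℝ)} (hp : p ≠ 0)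
    (h0 : ∑ i, p.1 i = 0) : 0 < marginalForm p := by
  have h1 : 0 ≤ ∑ i, p.1 i ^ 2 := Finset.sum_nonneg fun i _ => sq_nonneg _
  have h2 : 0 ≤ ∑ i, p.2 i ^ 2 := Finset.sum_nonneg fun i _ => sq_nonneg _
  unfold marginalForm
  rw [h0]
  by_contra hle
  apply hp
  have e1 : ∑ i, p.1 i ^ 2 = 0 := by linarith
  have e2 : ∑ i, p.2 i ^ 2 = 0 := by linarith
  rw [Finset.sum_eq_zero_iff_of_nonneg fun i _ => sq_nonneg _] at e1 e2
  exact Prod.ext (funext fun i => pow_eq_zero_iff two_ne_zero |>.1 (e1 i (Finset.mem_univ i)))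
    (funext fun i => pow_eq_zero_iff two_ne_zero |>.1 (e2 i (Finset.mem_univ i)))

lemma marginalForm_pos {m : ℕ} {I : Finset (Fin m)} (hI : I.card < m)
    (h : 2 * ((m : ℝ) - 2) * (I.card * (m - I.card)) < m ^ 2)
    {p : (Fin m → ℝ) × (Fin m → ℝ)} (hpE : p ∈ LinearMap.ker (marginalConstraints I))
    (hp : p ≠ 0) : 0 < marginalForm p := by
  obtain ⟨h1, h2⟩ := (mem_ker_marginalConstraints I p).1 hpE
  by_cases h0 : ∑ i, p.1 i = 0
  · exact marginalForm_pos_of_sum_eq_zero hp h0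
  have hsplit := Finset.sum_add_sum_compl I p.1
  have hsplit2 := Finset.sum_add_sum_compl I (fun i => p.1 i ^ 2)
  rw [sum_indexSign_mul] at h2
  have c1 := sq_sum_le_card_mul_sum_sq (s := I) (f := p.1)
  have c2 := sq_sum_le_card_mul_sum_sq (s := Iᶜ) (f := p.1)
  have c3 := sq_sum_le_card_mul_sum_sq (s := Finset.univ) (f := p.2)
  rw [Finset.card_compl, Fintype.card_fin, Nat.cast_sub hI.le] at c2
  rw [Finset.card_univ, Fintype.card_fin, ← h1] at c3
  unfold marginalForm
  rw [← hsplit2]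
  have e1 : ∑ i ∈ I, p.1 i = (∑ i, p.1 i) / 2 := by linarith
  have e2 : ∑ i ∈ Iᶜ, p.1 i = (∑ i, p.1 i) / 2 := by linarith
  rw [e1] at c1
  rw [e2] at c2
  have hms : (0 : ℝ) < m - I.card := sub_pos.2 (by exact_mod_cast hI)
  have hs : (0 : ℝ) < I.card := by
    rcases Nat.eq_zero_or_pos I.card with hz | hz
    · rw [Finset.card_eq_zero] at hz
      rw [hz, Finset.sum_empty] at e1
      exact (h0 (by linarith)).elim
    · exact_mod_cast hz
  have hT : 0 < (∑ i, p.1 i) ^ 2 := by positivity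
  generalize ∑ i, p.1 i = T at *
  generalize ∑ i ∈ I, p.1 i ^ 2 = a at *
  generalize ∑ i ∈ Iᶜ, p.1 i ^ 2 = b at *
  generalize ∑ i, p.2 i ^ 2 = c at *
  generalize (I.card : ℝ) = s at *
  have hm : (0 : ℝ) < m := by linarith
  generalize (m : ℝ) = m at *
  have k1 := mul_le_mul_of_nonneg_left c1 (by positivity : 0 ≤ m * (m - s))
  have k2 := mul_le_mul_of_nonneg_left c2 (by positivity : 0 ≤ m * s)
  have k3 := mul_le_mul_of_nonneg_left c3 (by positivity : 0 ≤ s * (m - s))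
  have k4 := mul_lt_mul_of_pos_left h hT
  have key : 0 < (m * s * (m - s)) * (a + b + c - T ^ 2 / 2) := by nlinarith
  exact (pos_iff_pos_of_mul_pos key).1 (by positivity)

lemma exists_marginalForm_neg {m : ℕ} {I : Finset (Fin m)} (hI : I.card < m) (hI0 : 0 < I.card)
    (h : (m : ℝ) ^ 2 < 2 * ((m : ℝ) - 2) * (I.card * (m - I.card))) :
    ∃ p ∈ LinearMap.ker (marginalConstraints I), marginalForm p < 0 := by
  have hms : (0 : ℝ) < m - I.card := sub_pos.2 (by exact_mod_cast hI)
  have hs : (0 : ℝ) < I.card := by exact_mod_cast hI0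
  have hm : (0 : ℝ) < m := by linarith
  let p : (Fin m → ℝ) × (Fin m → ℝ) :=
    (fun i => if i ∈ I then 1 / (2 * I.card) else 1 / (2 * (m - I.card)), fun _ => 1 / m)
  have hin : ∀ f : ℝ → ℝ, ∑ i ∈ I, f (p.1 i) = I.card * f (1 / (2 * I.card)) := fun f => by
    rw [← nsmul_eq_mul, ← Finset.sum_const]
    exact Finset.sum_congr rfl fun i hi => by simp [p, hi]
  have hout : ∀ f : ℝ → ℝ, ∑ i ∈ Iᶜ, f (p.1 i) = (m - I.card) * f (1 / (2 * (m - I.card))) :=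
    fun f => by
    have : ((m : ℝ) - I.card) = ((Iᶜ.card : ℕ) : ℝ) := by
      rw [Finset.card_compl, Fintype.card_fin, Nat.cast_sub hI.le]
    nth_rewrite 1 [this]
    rw [← nsmul_eq_mul, ← Finset.sum_const]
    exact Finset.sum_congr rfl fun i hi => by simp [p, Finset.mem_compl.1 hi]
  have hsum : ∑ i, p.1 i = 1 := by
    rw [← Finset.sum_add_sum_compl I, hin fun t => t, hout fun t => t]
    field_simp; norm_num
  have hsum2 : ∑ i, p.2 i = 1 := by
    simp [p]; field_simp
  refine ⟨p, (mem_ker_marginalConstraints I p).2 ⟨by rw [hsum, hsum2], ?_⟩, ?_⟩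
  · rw [sum_indexSign_mul, hin fun t => t, hout fun t => t]
    field_simp; norm_num
  · unfold marginalForm
    rw [← Finset.sum_add_sum_compl I, hin fun t => t ^ 2, hout fun t => t ^ 2, hsum]
    have : ∑ i, p.2 i ^ 2 = 1 / m := by simp [p]; field_simp
    rw [this]
    generalize (I.card : ℝ) = s at *
    generalize (m : ℝ) = m at *
    have key : s * (1 / (2 * s)) ^ 2 + (m - s) * (1 / (2 * (m - s))) ^ 2 + 1 / m - 1 ^ 2 / 2
        = (m ^ 2 - 2 * (m - 2) * (s * (m - s))) / (4 * m * s * (m - s)) := by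
      field_simp; ring
    rw [key]
    exact div_neg_of_neg_of_pos (by linarith) (by positivity)

lemma exists_le_ker_marginalConstraints {m : ℕ} (I : Finset (Fin m)) :
    ∃ W : Submodule ℝ ((Fin m → ℝ) × (Fin m → ℝ)),
      W ≤ LinearMap.ker (marginalConstraints I) ∧ (∀ p ∈ W, ∑ i, p.1 i = 0) ∧
      2 * m - 3 ≤ Module.finrank ℝ W := by
  let τ : (Fin m → ℝ) × (Fin m → ℝ) →ₗ[ℝ] ℝ :=
    (∑ i, LinearMap.proj i) ∘ₗ LinearMap.fst ℝ (Fin m → ℝ) (Fin m → ℝ)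
  let K := (marginalConstraints I).prod τ
  refine ⟨LinearMap.ker K, ?_, ?_, ?_⟩
  · rw [LinearMap.ker_prod]; exact inf_le_left
  · intro p hp
    rw [LinearMap.ker_prod] at hp
    have := hp.2
    simpa [τ] using this
  · have h1 := LinearMap.finrank_range_add_finrank_ker K
    have h2 := Submodule.finrank_le (LinearMap.range K)
    simp only [Module.finrank_prod, Module.finrank_self, Module.finrank_fin_fun] at h1 h2
    omega

lemma dotProduct_FMat_mulVec {n : Type*} [Fintype n] [DecidableEq n] (M : Matrix n n ℝ)
    (ℓ x : n → ℝ) :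
    x ⬝ᵥ FMat M ℓ *ᵥ x =
      -((fun p => x p - (∑ q, x q) * ℓ p) ⬝ᵥ M *ᵥ (fun p => x p - (∑ q, x q) * ℓ p)) := by
  have h1 : (1 - vecMulVec ℓ (fun _ => 1)) *ᵥ x = fun p => x p - (∑ q, x q) * ℓ p := by
    funext p
    rw [sub_mulVec, one_mulVec, vecMulVec_mulVec]
    simp [dotProduct, mul_comm]
  have h2 : x ᵥ* (1 - vecMulVec (fun _ => 1) ℓ) = fun p => x p - (∑ q, x q) * ℓ p := by
    rw [← mulVec_transpose, transpose_sub, transpose_one, transpose_vecMulVec, h1]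
  rw [FMat, neg_mulVec, dotProduct_neg, ← mulVec_mulVec, ← mulVec_mulVec, dotProduct_mulVec,
    h1, h2]

lemma FMat_isHermitian {n : Type*} [Fintype n] [DecidableEq n] {M : Matrix n n ℝ}
    (hM : M.IsSymm) (ℓ : n → ℝ) : (FMat M ℓ).IsHermitian := by
  rw [IsHermitian, conjTranspose_eq_transpose_of_trivial, FMat, transpose_neg, transpose_mul,
    transpose_mul, transpose_sub, transpose_sub, transpose_one, transpose_vecMulVec,
    transpose_vecMulVec, hM.eq, mul_assoc]

/-- A matrix with entries `3/2 − ε_p ε_q ([p₁ = q₁] + [p₂ = q₂] − 1/2)`, up to reindexing by `e`,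
induces `marginalForm` on the signed row and column sums. -/
lemma dotProduct_FMat_eq_marginalForm {m : ℕ} (I : Finset (Fin m))
    (e : Fin m × Fin m ≃ Fin m × Fin m) (D : Matrix (Fin m × Fin m) (Fin m × Fin m) ℝ)
    (hD : ∀ p q, D (e p) (e q) = 3 / 2 - indexSign I p.1 * indexSign I q.1 *
      ((if p.1 = q.1 then 1 else 0) + (if p.2 = q.2 then 1 else 0) - 1 / 2))
    (ℓ : Fin m × Fin m → ℝ) (hℓ : ∑ p, ℓ p = 1) (x : Fin m × Fin m → ℝ) :
    x ⬝ᵥ FMat D ℓ *ᵥ x = marginalForm (signedMarginals I e ℓ x) := by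
  have hy : ∑ p, (x p - (∑ q, x q) * ℓ p) = 0 := by
    rw [Finset.sum_sub_distrib, ← Finset.mul_sum, hℓ]; ring
  set y : Fin m × Fin m → ℝ := fun p => x p - (∑ q, x q) * ℓ p with hydef
  let w : Fin m × Fin m → ℝ := fun p => indexSign I p.1 * y (e p)
  have hΦ : signedMarginals I e ℓ x = (fun i => ∑ k, w (i, k), fun k => ∑ i, w (i, k)) := rfl
  have hye : ∑ p, y (e p) = 0 := (Equiv.sum_comp e y).trans hy
  have hrow : ∑ p, ∑ q, w p * w q * (if p.1 = q.1 then 1 else 0) = ∑ i, (∑ k, w (i, k)) ^ 2 := by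
    simp only [Fintype.sum_prod_type, sq, Finset.sum_mul_sum, mul_ite, mul_one, mul_zero]
    refine Finset.sum_congr rfl fun i _ => Finset.sum_congr rfl fun k _ => ?_
    rw [Finset.sum_comm]
    simp
  have hcol : ∑ p, ∑ q, w p * w q * (if p.2 = q.2 then 1 else 0) = ∑ k, (∑ i, w (i, k)) ^ 2 := by
    simp only [Fintype.sum_prod_type_right, sq, Finset.sum_mul_sum, mul_ite, mul_one, mul_zero]
    refine Finset.sum_congr rfl fun i _ => Finset.sum_congr rfl fun k _ => ?_
    rw [Finset.sum_comm]
    simp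
  have htot : ∑ p, ∑ q, w p * w q = (∑ i, ∑ k, w (i, k)) ^ 2 := by
    rw [← Finset.sum_mul_sum, ← sq, Fintype.sum_prod_type]
  have hform : y ⬝ᵥ D *ᵥ y = ∑ p, ∑ q, y (e p) * D (e p) (e q) * y (e q) := by
    simp only [dotProduct, mulVec]
    rw [← Equiv.sum_comp e]
    refine Finset.sum_congr rfl fun p _ => ?_
    rw [← Equiv.sum_comp e, Finset.mul_sum]
    exact Finset.sum_congr rfl fun q _ => (mul_assoc ..).symm
  have hentry : ∀ p q, y (e p) * D (e p) (e q) * y (e q) =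
      3 / 2 * (y (e p) * y (e q)) - w p * w q * (if p.1 = q.1 then 1 else 0) -
        w p * w q * (if p.2 = q.2 then 1 else 0) + 1 / 2 * (w p * w q) := fun p q => by
    rw [hD]; simp only [w]; ring
  rw [dotProduct_FMat_mulVec, ← hydef, hform, hΦ]
  have hyy : ∑ p, ∑ q, 3 / 2 * (y (e p) * y (e q)) = 0 := by
    simp only [← Finset.mul_sum, hye, mul_zero, Finset.sum_const_zero]
  have htot' : ∑ p, ∑ q, 1 / 2 * (w p * w q) = 1 / 2 * (∑ i, ∑ k, w (i, k)) ^ 2 := by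
    rw [← htot]; simp only [Finset.mul_sum]
  simp only [hentry, Finset.sum_add_distrib, Finset.sum_sub_distrib, hrow, hcol, htot', hyy,
    marginalForm]
  ring

/-- The entries of `D'` from the switching equation. -/
lemma switched_distance_apply {m : ℕ} (U : Finset (Fin m × Fin m))
    (A' : Matrix (Fin m × Fin m) (Fin m × Fin m) ℝ)
    (hA' : A' - (Jmat _ - 1 - A') =
      switchMat U * (hammingA m - (Jmat _ - 1 - hammingA m)) * switchMat U)
    (p q : Fin m × Fin m) :
    (A' + (2 : ℝ) • (Jmat (Fin m × Fin m) - 1 - A')) p q =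
      3 / 2 - (if p ∈ U then -1 else 1) * (if q ∈ U then -1 else 1) *
        ((if p.1 = q.1 then 1 else 0) + (if p.2 = q.2 then 1 else 0) - 1 / 2) := by
  have h := congrFun (congrFun hA' p) q
  rw [switchMat, mul_diagonal, diagonal_mul] at h
  simp only [Jmat, hammingA, Matrix.sub_apply, Matrix.add_apply, Matrix.smul_apply, of_apply, smul_eq_mul] at h ⊢
  by_cases hpq : p = q
  · subst hpq
    simp only [one_apply_eq, ne_eq, not_true, false_and, if_false, if_true] at h ⊢
    split_ifs at h ⊢ <;> linarith
  · have h' : ¬ (p.1 = q.1 ∧ p.2 = q.2) := fun h => hpq (Prod.ext h.1 h.2)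
    simp only [one_apply_ne hpq, ne_eq, hpq, not_false_eq_true, true_and] at h ⊢
    by_cases h1 : p.1 = q.1 <;> by_cases h2 : p.2 = q.2 <;>
      simp only [h1, h2, true_and, not_true, or_true, true_or, or_self, if_true, if_false] at h h' ⊢ <;>
      split_ifs at h ⊢ <;> linarith

lemma signature_FMat_of_entries {m : ℕ} (hm : 5 ≤ m) (I : Finset (Fin m)) (hs : I.card ≤ m / 2)
    (e : Fin m × Fin m ≃ Fin m × Fin m) (D : Matrix (Fin m × Fin m) (Fin m × Fin m) ℝ)
    (hD : ∀ p q, D (e p) (e q) = 3 / 2 - indexSign I p.1 * indexSign I q.1 *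
      ((if p.1 = q.1 then 1 else 0) + (if p.2 = q.2 then 1 else 0) - 1 / 2))
    (ℓ : Fin m × Fin m → ℝ) (hℓ : ∑ p, ℓ p = 1) :
    (2 * ((m : ℝ) - 2) * (I.card * (m - I.card)) < m ^ 2 →
      signature (FMat D ℓ) = (2 * m - 2, 0)) ∧
    ((m : ℝ) ^ 2 < 2 * ((m : ℝ) - 2) * (I.card * (m - I.card)) →
      signature (FMat D ℓ) = (2 * m - 3, 1)) := by
  have hIm : I.card < m := by omega
  obtain ⟨i₀, hi₀⟩ : ∃ i₀, i₀ ∉ I := by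
    by_contra! hall
    rw [Finset.eq_univ_of_forall hall, Finset.card_univ, Fintype.card_fin] at hIm
    exact lt_irrefl _ hIm
  have hDs : D.IsSymm := by
    ext p q
    rw [transpose_apply, ← e.apply_symm_apply p, ← e.apply_symm_apply q, hD, hD,
      mul_comm (indexSign I _)]
    simp only [eq_comm]
  have hH := FMat_isHermitian hDs ℓ
  have hform := dotProduct_FMat_eq_marginalForm I e D hD ℓ hℓ
  have hrange := range_signedMarginals (by omega) I e ℓ hℓ
  have hle := sigP_add_sigN_le hH _ _ hform
  have hlow := finrank_le_sigP hH _ _ hform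
  rw [hrange] at hle hlow
  rw [finrank_ker_marginalConstraints I hi₀] at hle
  have hP : sigP (FMat D ℓ) = Nat.card {i // 0 < 1 * hH.eigenvalues i} := by
    rw [sigP, dif_pos hH]; simp only [one_mul]
  have hN : sigN (FMat D ℓ) = Nat.card {i // 0 < -1 * hH.eigenvalues i} := by
    rw [sigN, dif_pos hH]; simp only [neg_one_mul, neg_pos]
  unfold signature
  refine ⟨fun h => ?_, fun h => ?_⟩
  · have h1 := hlow 1 _ le_rfl fun p hp hp0 => by
      rw [one_mul]; exact marginalForm_pos hIm h hp hp0
    rw [finrank_ker_marginalConstraints I hi₀, ← hP] at h1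
    exact Prod.ext (by simp only; omega) (by simp only; omega)
  · obtain ⟨W, hWE, hW0, hWdim⟩ := exists_le_ker_marginalConstraints I
    have h1 := hlow 1 W hWE fun p hp hp0 => by
      rw [one_mul]; exact marginalForm_pos_of_sum_eq_zero hp0 (hW0 p hp)
    have hI0 : 0 < I.card := by
      rcases Nat.eq_zero_or_pos I.card with hz | hz
      · rw [hz] at h
        have : (0 : ℝ) ≤ (m : ℝ) ^ 2 := sq_nonneg _
        norm_num at h
        linarith
      · exact hz
    obtain ⟨p, hpE, hpneg⟩ := exists_marginalForm_neg hIm hI0 h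
    have hp0 : p ≠ 0 := by
      rintro rfl
      simp [marginalForm] at hpneg
    have h2 := hlow (-1) (ℝ ∙ p) ((Submodule.span_singleton_le_iff_mem _ _).2 hpE)
      fun w hw hw0 => by
        obtain ⟨c, rfl⟩ := Submodule.mem_span_singleton.1 hw
        have hc : c ≠ 0 := fun hc => hw0 (by rw [hc, zero_smul])
        have : marginalForm (c • p) = c ^ 2 * marginalForm p := by
          simp only [marginalForm, Prod.smul_fst, Prod.smul_snd, Pi.smul_apply, smul_eq_mul,
            mul_pow, ← Finset.mul_sum]
          ring
        rw [this]
        have := mul_neg_of_pos_of_neg (by positivity : 0 < c ^ 2) hpneg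
        linarith
    rw [finrank_span_singleton hp0, ← hN] at h2
    rw [← hP] at h1
    exact Prod.ext (by simp only; omega) (by simp only; omega)

lemma card_mul_lt_of_lt_threshold {m s : ℝ} (hm : 5 ≤ m)
    (h : s < m / 2 * (1 - Real.sqrt ((m - 4) / (m - 2)))) :
    2 * (m - 2) * (s * (m - s)) < m ^ 2 := by
  have hr := Real.sqrt_nonneg ((m - 4) / (m - 2))
  have hr2 := Real.sq_sqrt (div_nonneg (by linarith) (by linarith) : 0 ≤ (m - 4) / (m - 2))
  rw [eq_div_iff (by linarith)] at hr2
  generalize Real.sqrt ((m - 4) / (m - 2)) = r at *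
  have h1 : m * r < m - 2 * s := by linarith
  have h2 : (m * r) ^ 2 < (m - 2 * s) ^ 2 := pow_lt_pow_left₀ h1 (by positivity) two_ne_zero
  have h3 := mul_lt_mul_of_pos_right h2 (by linarith : 0 < m - 2)
  have h4 : (m * r) ^ 2 * (m - 2) = m ^ 2 * (m - 4) := by rw [← hr2]; ring
  linarith

lemma lt_card_mul_of_threshold_lt {m s : ℝ} (hm : 5 ≤ m) (hs : 2 * s ≤ m)
    (h : m / 2 * (1 - Real.sqrt ((m - 4) / (m - 2))) < s) :
    m ^ 2 < 2 * (m - 2) * (s * (m - s)) := by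
  have hr2 := Real.sq_sqrt (div_nonneg (by linarith) (by linarith) : 0 ≤ (m - 4) / (m - 2))
  rw [eq_div_iff (by linarith)] at hr2
  generalize Real.sqrt ((m - 4) / (m - 2)) = r at *
  have h1 : m - 2 * s < m * r := by linarith
  have h2 : (m - 2 * s) ^ 2 < (m * r) ^ 2 := pow_lt_pow_left₀ h1 (by linarith) two_ne_zero
  have h3 := mul_lt_mul_of_pos_right h2 (by linarith : 0 < m - 2)
  have h4 : (m * r) ^ 2 * (m - 2) = m ^ 2 * (m - 4) := by rw [← hr2]; ring
  linarith

/-- let `m ≥ 5`, `G = H(2,m)` the Hamming graph on `m²` vertices,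
`I ⊆ {1,…,m}` with `|I| = s ≤ ⌊m/2⌋`, and `U = ⋃_{i∈I} U_i` a disjoint union of `s`
Delsarte cliques of the same type (or symmetrically `U = ⋃_{i∈I} V_i`).  Let
`D' = A' + 2Ā'` be the dissimilarity matrix (distances `a = 1`, `b = 2`) of the Seidel
switch of `G` with respect to `U`, and `t_m = (m/2)(1 − √((m−4)/(m−2)))`.  Then for
every `ℓ` with `ℓᵀ j = 1`: if `0 ≤ s < t_m` the signature of `F_{D'}(ℓ)` is
`(2m − 2, 0)`, and if `t_m < s ≤ ⌊m/2⌋` it is `(2m − 3, 1)`. -/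
theorem stmt19 (m : ℕ) (hm : 5 ≤ m)
    (I : Finset (Fin m)) (hs : I.card ≤ m / 2)
    (U : Finset (Fin m × Fin m))
    (hU : (∀ p : Fin m × Fin m, p ∈ U ↔ p.1 ∈ I) ∨
          (∀ p : Fin m × Fin m, p ∈ U ↔ p.2 ∈ I))
    (A' : Matrix (Fin m × Fin m) (Fin m × Fin m) ℝ)
    (hA'01 : ∀ p q, A' p q = 0 ∨ A' p q = 1)
    (hA'diag : ∀ p, A' p p = 0) (hA'sym : A'.IsSymm)
    (hA' : A' - (Jmat _ - 1 - A') =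
      switchMat U * (hammingA m - (Jmat _ - 1 - hammingA m)) * switchMat U)
    (D' : Matrix (Fin m × Fin m) (Fin m × Fin m) ℝ)
    (hD' : D' = A' + (2 : ℝ) • (Jmat _ - 1 - A')) :
    ∀ ℓ, ∑ p, ℓ p = 1 →
      ((I.card : ℝ) < ((m : ℝ) / 2) * (1 - Real.sqrt (((m : ℝ) - 4) / ((m : ℝ) - 2))) →
        signature (FMat D' ℓ) = (2 * m - 2, 0)) ∧
      (((m : ℝ) / 2) * (1 - Real.sqrt (((m : ℝ) - 4) / ((m : ℝ) - 2))) < (I.card : ℝ) →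
        signature (FMat D' ℓ) = (2 * m - 3, 1)) := by
  intro ℓ hℓ
  have hm' : (5 : ℝ) ≤ m := by exact_mod_cast hm
  have hs' : 2 * (I.card : ℝ) ≤ m := by
    have : 2 * I.card ≤ m := by omega
    exact_mod_cast this
  have hentry := switched_distance_apply U A' hA'
  rw [← hD'] at hentry
  have key : ∃ e : Fin m × Fin m ≃ Fin m × Fin m, ∀ p q, D' (e p) (e q) =
      3 / 2 - indexSign I p.1 * indexSign I q.1 *
        ((if p.1 = q.1 then 1 else 0) + (if p.2 = q.2 then 1 else 0) - 1 / 2) := by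
    rcases hU with hU | hU
    · refine ⟨Equiv.refl _, fun p q => ?_⟩
      simp only [Equiv.refl_apply, hentry, hU, indexSign]
    · refine ⟨Equiv.prodComm _ _, fun p q => ?_⟩
      simp only [Equiv.prodComm_apply, hentry, hU, indexSign, Prod.fst_swap, Prod.snd_swap]
      ring
  obtain ⟨e, he⟩ := key
  obtain ⟨hpos, hneg⟩ := signature_FMat_of_entries hm I hs e D' he ℓ hℓ
  exact ⟨fun h => hpos (card_mul_lt_of_lt_threshold hm' h),
    fun h => hneg (lt_card_mul_of_threshold_lt hm' hs' h)⟩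
end
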